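/- arXiv:2203.16026 — 5 statements merged into one kernel-verified Lean document; each statement's English description precedes it below -/
import Mathlib

section
/- Let 0 < r ≤ 1 and set 1/v = 1/r − 1 (v = ∞ when r = 1). Every r-nuclear operator T : X → Y between Banach spaces factors through an S_v-operator on a Hilbert space; moreover, for every ε > 0 one can choose a factorization T = A∘U∘B with B : X → ℓ², U ∈ S_v(ℓ²), A : ℓ² → Y and ‖A‖·σ_v(U)·‖B‖ ≤ (1+ε)·ν_r(T). -/
open scoped ENNReal NNReal ComplexConjugate
open MeasureTheory

noncomputable section

/-- The `n`-th approximation number (indexed from `0`, so that `opApproxNum U n`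
is the classical `(n+1)`-st approximation number `a_{n+1}(U)`):
the distance from `U` to operators of rank at most `n`.
For operators between Hilbert spaces, the approximation numbers coincide with the
singular numbers. -/
def opApproxNum {H K : Type*} [SeminormedAddCommGroup H] [NormedSpace ℂ H]
    [SeminormedAddCommGroup K] [NormedSpace ℂ K] (U : H →L[ℂ] K) (n : ℕ) : ℝ :=
  sInf { c : ℝ | ∃ F : H →L[ℂ] K,
    FiniteDimensional ℂ (LinearMap.range (F : H →ₗ[ℂ] K)) ∧
    Module.finrank ℂ (LinearMap.range (F : H →ₗ[ℂ] K)) ≤ n ∧ ‖U - F‖ = c }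

/-- Membership in the Schatten class `S_p` of a Hilbert space, `p ∈ (0,∞]`:
for finite `p` the operator is compact with singular numbers (= approximation numbers)
in `ℓ^p`; following the convention of the paper, `S_∞` means all bounded operators. -/
def MemSchatten {H : Type*} [NormedAddCommGroup H] [InnerProductSpace ℂ H]
    (p : ℝ≥0∞) (U : H →L[ℂ] H) : Prop :=
  p = ∞ ∨ (IsCompactOperator U ∧ Summable fun n : ℕ => opApproxNum U n ^ p.toReal)

/-- The Schatten quasi-norm `σ_p`; for `p = ∞` it is the operator norm. -/
def schattenNorm {H : Type*} [NormedAddCommGroup H] [InnerProductSpace ℂ H]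
    (p : ℝ≥0∞) (U : H →L[ℂ] H) : ℝ :=
  if p = ∞ then ‖U‖ else (∑' n : ℕ, opApproxNum U n ^ p.toReal) ^ (1 / p.toReal)

/-- `T : X → Y` factors through an `S_p`-operator on a Hilbert space. -/
def FactorsThroughSchatten {X Y : Type*} [SeminormedAddCommGroup X] [NormedSpace ℂ X]
    [SeminormedAddCommGroup Y] [NormedSpace ℂ Y] (p : ℝ≥0∞) (T : X →L[ℂ] Y) : Prop :=
  ∃ (H : Type) (_ : NormedAddCommGroup H) (_ : InnerProductSpace ℂ H) (_ : CompleteSpace H)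
    (B : X →L[ℂ] H) (U : H →L[ℂ] H) (A : H →L[ℂ] Y),
    MemSchatten p U ∧ ∀ x, A (U (B x)) = T x

/-- `T : X → Y` factors through a (bounded operator on a) Hilbert space. -/
def FactorsThroughHilbert {X Y : Type*} [SeminormedAddCommGroup X] [NormedSpace ℂ X]
    [SeminormedAddCommGroup Y] [NormedSpace ℂ Y] (T : X →L[ℂ] Y) : Prop :=
  ∃ (H : Type) (_ : NormedAddCommGroup H) (_ : InnerProductSpace ℂ H) (_ : CompleteSpace H)
    (A : X →L[ℂ] H) (B : H →L[ℂ] Y), ∀ x, B (A x) = T x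

/-- `T` is `r`-absolutely summing: `Σ ‖T x_n‖^r ≤ C^r · sup_{‖x'‖≤1} Σ |⟨x_n, x'⟩|^r`
(the supremum is expressed through its upper bounds). -/
def AbsSumming {X Y : Type*} [SeminormedAddCommGroup X] [NormedSpace ℂ X]
    [SeminormedAddCommGroup Y] [NormedSpace ℂ Y] (r : ℝ) (T : X →L[ℂ] Y) : Prop :=
  ∃ C : ℝ, 0 < C ∧ ∀ (N : ℕ) (x : Fin N → X) (b : ℝ),
    (∀ x' : X →L[ℂ] ℂ, ‖x'‖ ≤ 1 → ∑ n, ‖x' (x n)‖ ^ r ≤ b) →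
    ∑ n, ‖T (x n)‖ ^ r ≤ C ^ r * b

/-- `T` is `r`-nuclear (`0 < r ≤ 1`): `T x = Σ μ_n ⟨x'_n, x⟩ y_n` with `‖x'_n‖ ≤ 1`,
`‖y_n‖ ≤ 1` and `(μ_n) ∈ ℓ^r`. -/
def RNuclear {X Y : Type*} [SeminormedAddCommGroup X] [NormedSpace ℂ X]
    [SeminormedAddCommGroup Y] [NormedSpace ℂ Y] (r : ℝ) (T : X →L[ℂ] Y) : Prop :=
  ∃ (μ : ℕ → ℂ) (x' : ℕ → X →L[ℂ] ℂ) (y : ℕ → Y),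
    (∀ n, ‖x' n‖ ≤ 1) ∧ (∀ n, ‖y n‖ ≤ 1) ∧
    (Summable fun n => ‖μ n‖ ^ r) ∧
    ∀ x, T x = ∑' n, (μ n * x' n x) • y n

/-- The `r`-nuclear quasi-norm `ν_r(T)`. -/
def nuclearNorm {X Y : Type*} [SeminormedAddCommGroup X] [NormedSpace ℂ X]
    [SeminormedAddCommGroup Y] [NormedSpace ℂ Y] (r : ℝ) (T : X →L[ℂ] Y) : ℝ :=
  sInf { c : ℝ | ∃ (μ : ℕ → ℂ) (x' : ℕ → X →L[ℂ] ℂ) (y : ℕ → Y),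
    (∀ n, ‖x' n‖ ≤ 1) ∧ (∀ n, ‖y n‖ ≤ 1) ∧
    (Summable fun n => ‖μ n‖ ^ r) ∧
    (∀ x, T x = ∑' n, (μ n * x' n x) • y n) ∧
    (∑' n, ‖μ n‖ ^ r) ^ (1 / r) = c }

/-- `ℓ²` over `ℕ`. -/
abbrev ell2 : Type := lp (fun _ : ℕ => ℂ) 2

end

noncomputable section

lemma summable_norm_sq_ell2 (f : ell2) : Summable fun n => ‖f n‖ ^ (2 : ℝ) := by
  simpa using (lp.memℓp f).summable (by norm_num)

lemma ell2_norm_le {f : ell2} {C : ℝ} (hC : 0 ≤ C) (hf : ∑' n, ‖f n‖ ^ (2 : ℝ) ≤ C ^ (2 : ℝ)) :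
    ‖f‖ ≤ C :=
  lp.norm_le_of_tsum_le (by norm_num) hC (by simpa using hf)

lemma memℓp_two_of_summable {f : ℕ → ℂ} (hf : Summable fun n => ‖f n‖ ^ (2 : ℝ)) :
    Memℓp f 2 :=
  memℓp_gen (by simpa using hf)

/-- An operator acting diagonally is bounded by the supremum of its diagonal entries. -/
lemma opNorm_le_of_diagonal {D : ell2 →L[ℂ] ell2} {d : ℕ → ℂ}
    (hD : ∀ f n, D f n = d n * f n) {C : ℝ} (hC : 0 ≤ C) (hd : ∀ n, ‖d n‖ ≤ C) : ‖D‖ ≤ C := by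
  refine D.opNorm_le_bound hC fun f => ?_
  have h : ‖D f‖ ≤ ‖(C : ℂ) • f‖ := lp.norm_mono (by norm_num) fun n => by
    rw [hD, lp.coeFn_smul, Pi.smul_apply, norm_mul, norm_smul, Complex.norm_real,
      Real.norm_of_nonneg hC]
    exact mul_le_mul_of_nonneg_right (hd n) (norm_nonneg _)
  rwa [norm_smul, Complex.norm_real, Real.norm_of_nonneg hC] at h

lemma exists_diagonal {d : ℕ → ℂ} {C : ℝ} (hd : ∀ n, ‖d n‖ ≤ C) :
    ∃ D : ell2 →L[ℂ] ell2, ∀ f n, D f n = d n * f n := by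
  have hC : 0 ≤ C := (norm_nonneg _).trans (hd 0)
  have hmem (f : ell2) : Memℓp (fun n => d n * f n) 2 := by
    refine memℓp_two_of_summable <| .of_nonneg_of_le (fun n => by positivity) (fun n => ?_)
      ((summable_norm_sq_ell2 f).mul_left (C ^ (2 : ℝ)))
    rw [norm_mul, Real.mul_rpow (norm_nonneg _) (norm_nonneg _)]
    gcongr
    exact hd n
  let L : ell2 →ₗ[ℂ] ell2 :=
    { toFun := fun f => ⟨fun n => d n * f n, hmem f⟩
      map_add' := fun f g => by ext n; exact mul_add _ _ _
      map_smul' := fun c f => by ext n; exact mul_left_comm _ _ _ }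
  refine ⟨L.mkContinuous C fun f => ?_, fun f n => rfl⟩
  have h : ‖L f‖ ≤ ‖(C : ℂ) • f‖ := lp.norm_mono (by norm_num) fun n => by
    change ‖d n * f n‖ ≤ ‖(C : ℂ) * f n‖
    rw [norm_mul, norm_mul, Complex.norm_real, Real.norm_of_nonneg hC]
    exact mul_le_mul_of_nonneg_right (hd n) (norm_nonneg _)
  rwa [norm_smul, Complex.norm_real, Real.norm_of_nonneg hC] at h

open scoped Classical in
lemma range_le_span_of_diagonal {D : ell2 →L[ℂ] ell2} {d : ℕ → ℂ}
    (hD : ∀ f n, D f n = d n * f n) {S : Finset ℕ} (hS : ∀ n ∉ S, d n = 0) :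
    LinearMap.range (D : ell2 →ₗ[ℂ] ell2) ≤
      Submodule.span ℂ (S.image fun n => (lp.single 2 n (1 : ℂ) : ell2)) := by
  rintro _ ⟨f, rfl⟩
  have h : D f = ∑ k ∈ S, (d k * f k) • (lp.single 2 k (1 : ℂ) : ell2) := by
    ext n
    rw [lp.coeFn_sum, Finset.sum_apply, hD]
    simp only [lp.coeFn_smul, Pi.smul_apply, lp.single_apply, Pi.single_apply, smul_eq_mul,
      mul_ite, mul_one, mul_zero, Finset.sum_ite_eq]
    split_ifs with hn
    · rfl
    · rw [hS n hn, zero_mul]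
  rw [ContinuousLinearMap.coe_coe, h]
  refine Submodule.sum_mem _ fun k hk => Submodule.smul_mem _ _ (Submodule.subset_span ?_)
  exact Finset.mem_coe.2 (Finset.mem_image_of_mem _ hk)

/-- Truncating a diagonal operator to the entries in a finite set `S`. -/
lemma exists_diagonal_truncation {D : ell2 →L[ℂ] ell2} {d : ℕ → ℂ}
    (hD : ∀ f n, D f n = d n * f n) (S : Finset ℕ) {C : ℝ} (hC : 0 ≤ C)
    (hd : ∀ n ∉ S, ‖d n‖ ≤ C) :
    ∃ F : ell2 →L[ℂ] ell2, FiniteDimensional ℂ (LinearMap.range (F : ell2 →ₗ[ℂ] ell2)) ∧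
      Module.finrank ℂ (LinearMap.range (F : ell2 →ₗ[ℂ] ell2)) ≤ S.card ∧ ‖D - F‖ ≤ C := by
  classical
  obtain ⟨P, hP⟩ := exists_diagonal (d := fun n => if n ∈ S then 1 else 0) (C := 1)
    (fun n => by split_ifs <;> simp)
  have hF (f : ell2) (n : ℕ) : (D ∘L P) f n = (if n ∈ S then d n else 0) * f n := by
    rw [ContinuousLinearMap.comp_apply, hD, hP]
    split_ifs <;> simp
  have hle := range_le_span_of_diagonal hF (S := S) fun n hn => if_neg hn
  have hfin := FiniteDimensional.span_finset ℂ
    (S.image fun n => (lp.single 2 n (1 : ℂ) : ell2))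
  refine ⟨D ∘L P, Submodule.finiteDimensional_of_le hle,
    (Submodule.finrank_mono hle).trans ((finrank_span_finset_le_card _).trans
      Finset.card_image_le), ?_⟩
  refine opNorm_le_of_diagonal (d := fun n => if n ∈ S then 0 else d n) (fun f n => ?_) hC
    fun n => ?_
  · rw [sub_apply, lp.coeFn_sub, Pi.sub_apply, hF, hD]
    split_ifs <;> simp
  · split_ifs with hn
    · simpa using hC
    · exact hd n hn

section Approximation

variable {E F : Type*} [NormedAddCommGroup E] [NormedSpace ℂ E]
  [NormedAddCommGroup F] [NormedSpace ℂ F]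

lemma isCompactOperator_of_finiteDimensional_range (U : E →L[ℂ] F)
    [FiniteDimensional ℂ (LinearMap.range (U : E →ₗ[ℂ] F))] : IsCompactOperator U := by
  let R := LinearMap.range (U : E →ₗ[ℂ] F)
  let V : E →L[ℂ] R := U.codRestrict R fun x => ⟨x, rfl⟩
  exact (((isCompactOperator_id_iff_finiteDimensional (𝕜 := ℂ) (E := R)).2 inferInstance).comp_clm
    V).clm_comp R.subtypeL

lemma opApproxNum_nonneg (U : E →L[ℂ] F) (n : ℕ) : 0 ≤ opApproxNum U n :=
  Real.sInf_nonneg (by rintro _ ⟨_, _, _, rfl⟩; exact norm_nonneg _)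

lemma opApproxNum_le {U V : E →L[ℂ] F} {n : ℕ}
    (hV : FiniteDimensional ℂ (LinearMap.range (V : E →ₗ[ℂ] F)))
    (hn : Module.finrank ℂ (LinearMap.range (V : E →ₗ[ℂ] F)) ≤ n) :
    opApproxNum U n ≤ ‖U - V‖ :=
  csInf_le ⟨0, by rintro _ ⟨_, _, _, rfl⟩; exact norm_nonneg _⟩ ⟨V, hV, hn, rfl⟩

end Approximation

/-- A nonnegative null sequence attains its maximum off every finite set. -/
lemma exists_forall_le_notMem_finset {g : ℕ → ℝ} (hg0 : ∀ n, 0 ≤ g n)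
    (hg : Filter.Tendsto g Filter.cofinite (nhds 0)) (S : Finset ℕ) :
    ∃ k ∉ S, ∀ j ∉ S, g j ≤ g k := by
  by_cases h : ∃ j ∉ S, 0 < g j
  · obtain ⟨j, hjS, hj⟩ := h
    have hfin : {n | ¬ g n < g j}.Finite := Filter.eventually_cofinite.1 (hg.eventually_lt_const hj)
    obtain ⟨k, ⟨hkS, hkj⟩, hk⟩ := Set.exists_max_image {n | n ∉ S ∧ ¬ g n < g j} g
      (hfin.subset fun n hn => hn.2) ⟨j, hjS, lt_irrefl _⟩
    refine ⟨k, hkS, fun i hi => ?_⟩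
    by_cases hij : g i < g j
    · exact hij.le.trans (not_lt.1 hkj)
    · exact hk i ⟨hi, hij⟩
  · push Not at h
    obtain ⟨k, hk⟩ := Infinite.exists_notMem_finset S
    exact ⟨k, hk, fun j hj => (h j hj).trans (hg0 k)⟩

section Diagonal

variable {D : ell2 →L[ℂ] ell2} {d : ℕ → ℂ}

lemma isCompactOperator_of_diagonal (hD : ∀ f n, D f n = d n * f n)
    (hd : Filter.Tendsto (fun n => ‖d n‖) Filter.cofinite (nhds 0)) : IsCompactOperator D := by
  have h (k : ℕ) : ∃ F : ell2 →L[ℂ] ell2, IsCompactOperator F ∧ ‖D - F‖ ≤ 1 / ((k : ℝ) + 1) := by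
    have hfin := Filter.eventually_cofinite.1
      (hd.eventually_lt_const (Nat.one_div_pos_of_nat (α := ℝ) (n := k)))
    obtain ⟨F, hF, -, hle⟩ := exists_diagonal_truncation hD hfin.toFinset
      (C := 1 / ((k : ℝ) + 1)) (by positivity)
      (fun n hn => by simpa using (not_not.1 (mt hfin.mem_toFinset.2 hn)).le)
    exact ⟨F, isCompactOperator_of_finiteDimensional_range F, hle⟩
  choose F hF hle using h
  refine isCompactOperator_of_tendsto (l := Filter.atTop) (F := F) ?_ (.of_forall hF)
  rw [tendsto_iff_norm_sub_tendsto_zero]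
  refine squeeze_zero (fun _ => norm_nonneg _) (fun k => ?_)
    (tendsto_one_div_add_atTop_nhds_zero_nat (𝕜 := ℝ))
  rw [norm_sub_rev]
  exact hle k

lemma sum_opApproxNum_rpow_le (hD : ∀ f n, D f n = d n * f n)
    (hd : Filter.Tendsto (fun n => ‖d n‖) Filter.cofinite (nhds 0)) {p : ℝ} (hp : 0 ≤ p) (N : ℕ) :
    ∃ S : Finset ℕ, S.card = N ∧
      ∑ n ∈ Finset.range N, opApproxNum D n ^ p ≤ ∑ n ∈ S, ‖d n‖ ^ p := by
  classical
  induction N with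
  | zero => exact ⟨∅, by simp⟩
  | succ N ih =>
    obtain ⟨S, hS, hle⟩ := ih
    obtain ⟨k, hkS, hk⟩ := exists_forall_le_notMem_finset (fun n => norm_nonneg (d n)) hd S
    obtain ⟨F, hF, hrank, hDF⟩ := exists_diagonal_truncation hD S (norm_nonneg (d k)) hk
    refine ⟨insert k S, by rw [Finset.card_insert_of_notMem hkS, hS], ?_⟩
    rw [Finset.sum_range_succ, Finset.sum_insert hkS, add_comm]
    exact add_le_add (Real.rpow_le_rpow (opApproxNum_nonneg _ _)
      ((opApproxNum_le hF (hrank.trans hS.le)).trans hDF) hp) hle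

/-- A diagonal operator with `ℓ^p` diagonal belongs to `S_p`, with the expected bound. -/
lemma schatten_of_diagonal (hD : ∀ f n, D f n = d n * f n) {p : ℝ≥0∞} (hp0 : 0 < p.toReal)
    (hd : Summable fun n => ‖d n‖ ^ p.toReal) :
    MemSchatten p D ∧ schattenNorm p D ≤ (∑' n, ‖d n‖ ^ p.toReal) ^ (1 / p.toReal) := by
  have hlim : Filter.Tendsto (fun n => ‖d n‖) Filter.cofinite (nhds 0) := by
    have h := hd.tendsto_cofinite_zero.rpow_const (p := 1 / p.toReal) (.inr (by positivity))
    rw [Real.zero_rpow (by positivity)] at h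
    refine h.congr fun n => ?_
    rw [one_div, Real.rpow_rpow_inv (norm_nonneg _) hp0.ne']
  have hnonneg (n : ℕ) : 0 ≤ opApproxNum D n ^ p.toReal :=
    Real.rpow_nonneg (opApproxNum_nonneg D n) _
  have hsum (N : ℕ) : ∑ n ∈ Finset.range N, opApproxNum D n ^ p.toReal ≤
      ∑' n, ‖d n‖ ^ p.toReal := by
    obtain ⟨S, -, hS⟩ := sum_opApproxNum_rpow_le hD hlim hp0.le N
    exact hS.trans (hd.sum_le_tsum S fun n _ => by positivity)
  refine ⟨.inr ⟨isCompactOperator_of_diagonal hD hlim,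
    summable_of_sum_range_le hnonneg hsum⟩, ?_⟩
  rw [schattenNorm, if_neg (by rintro rfl; simp at hp0)]
  exact Real.rpow_le_rpow (tsum_nonneg hnonneg) (Real.tsum_le_of_sum_range_le hnonneg hsum)
    (by positivity)

end Diagonal

lemma schattenNorm_nonneg {H : Type*} [NormedAddCommGroup H] [InnerProductSpace ℂ H]
    (p : ℝ≥0∞) (U : H →L[ℂ] H) : 0 ≤ schattenNorm p U := by
  unfold schattenNorm
  split_ifs
  · exact norm_nonneg _
  · exact Real.rpow_nonneg (tsum_nonneg fun n => Real.rpow_nonneg (opApproxNum_nonneg U n) _) _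

/-- Functionals with square-summable norm bounds assemble to an operator into `ℓ²`. -/
lemma exists_toEll2 {X : Type*} [NormedAddCommGroup X] [NormedSpace ℂ X] {φ : ℕ → X →L[ℂ] ℂ}
    {b : ℕ → ℝ} (hφ : ∀ n, ‖φ n‖ ≤ b n) {C : ℝ} (hC : 0 ≤ C)
    (hb : HasSum (fun n => b n ^ (2 : ℝ)) (C ^ (2 : ℝ))) :
    ∃ B : X →L[ℂ] ell2, ‖B‖ ≤ C ∧ ∀ x n, B x n = φ n x := by
  have hle (x : X) (n : ℕ) : ‖φ n x‖ ^ (2 : ℝ) ≤ b n ^ (2 : ℝ) * ‖x‖ ^ (2 : ℝ) := by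
    rw [← Real.mul_rpow ((norm_nonneg _).trans (hφ n)) (norm_nonneg _)]
    exact Real.rpow_le_rpow (norm_nonneg _) ((φ n).le_of_opNorm_le (hφ n) x) zero_le_two
  have hsum (x : X) : Summable fun n => ‖φ n x‖ ^ (2 : ℝ) :=
    .of_nonneg_of_le (fun n => by positivity) (hle x) (hb.summable.mul_right _)
  let L : X →ₗ[ℂ] ell2 :=
    { toFun := fun x => ⟨fun n => φ n x, memℓp_two_of_summable (hsum x)⟩
      map_add' := fun x y => by ext n; exact map_add _ _ _
      map_smul' := fun c x => by ext n; exact map_smul _ _ _ }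
  refine ⟨L.mkContinuous C fun x => ?_, LinearMap.mkContinuous_norm_le _ hC _, fun x n => rfl⟩
  refine ell2_norm_le (by positivity) ?_
  rw [Real.mul_rpow hC (norm_nonneg _), ← hb.tsum_eq, ← tsum_mul_right]
  exact (hsum x).tsum_le_tsum (hle x) (hb.summable.mul_right _)

/-- Vectors with square-summable norm bounds define an operator on `ℓ²` by superposition. -/
lemma exists_ofEll2 {Y : Type*} [NormedAddCommGroup Y] [NormedSpace ℂ Y] [CompleteSpace Y]
    {z : ℕ → Y} {b : ℕ → ℝ} (hz : ∀ n, ‖z n‖ ≤ b n) {C : ℝ} (hC : 0 ≤ C)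
    (hb : HasSum (fun n => b n ^ (2 : ℝ)) (C ^ (2 : ℝ))) :
    ∃ A : ell2 →L[ℂ] Y, ‖A‖ ≤ C ∧ ∀ f, A f = ∑' n, f n • z n := by
  have hbound (f : ell2) : (Summable fun n => ‖f n‖ * b n) ∧
      ∑' n, ‖f n‖ * b n ≤ C * ‖f‖ := by
    obtain ⟨hsum, hle⟩ := Real.summable_and_inner_le_Lp_mul_Lq_tsum_of_nonneg
      Real.HolderConjugate.two_two (fun n => norm_nonneg (f n))
      (fun n => (norm_nonneg _).trans (hz n)) (summable_norm_sq_ell2 f) hb.summable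
    refine ⟨hsum, hle.trans_eq ?_⟩
    have hf : ‖f‖ = (∑' n, ‖f n‖ ^ (2 : ℝ)) ^ (1 / (2 : ℝ)) := by
      simpa using lp.norm_eq_tsum_rpow (p := 2) (by norm_num) f
    rw [hb.tsum_eq, ← hf, one_div, Real.rpow_rpow_inv hC two_ne_zero, mul_comm]
  have hterm (f : ell2) (n : ℕ) : ‖f n • z n‖ ≤ ‖f n‖ * b n := by
    rw [norm_smul]
    exact mul_le_mul_of_nonneg_left (hz n) (norm_nonneg _)
  have hsum (f : ell2) : Summable fun n => f n • z n :=
    .of_norm_bounded (hbound f).1 (hterm f)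
  let L : ell2 →ₗ[ℂ] Y :=
    { toFun := fun f => ∑' n, f n • z n
      map_add' := fun f g => by
        rw [← (hsum f).tsum_add (hsum g)]
        exact tsum_congr fun n => add_smul _ _ _
      map_smul' := fun c f => by
        rw [RingHom.id_apply, ← (hsum f).tsum_const_smul c]
        exact tsum_congr fun n => mul_smul _ _ _ }
  refine ⟨L.mkContinuous C fun f => ?_, LinearMap.mkContinuous_norm_le _ hC _, fun f => rfl⟩
  exact (tsum_of_norm_bounded (hbound f).1.hasSum (hterm f)).trans (hbound f).2

/-- The factorization through `ℓ²` attached to an `r`-nuclear representation. -/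
lemma exists_schatten_factorization {X Y : Type*} [NormedAddCommGroup X] [NormedSpace ℂ X]
    [NormedAddCommGroup Y] [NormedSpace ℂ Y] [CompleteSpace Y]
    {r : ℝ} (hr0 : 0 < r) (hr1 : r ≤ 1)
    {v : ℝ≥0∞} (hv : 1 / v = ENNReal.ofReal (1 / r - 1)) {T : X →L[ℂ] Y}
    {μ : ℕ → ℂ} {x' : ℕ → X →L[ℂ] ℂ} {y : ℕ → Y} (hx' : ∀ n, ‖x' n‖ ≤ 1) (hy : ∀ n, ‖y n‖ ≤ 1)
    (hμ : Summable fun n => ‖μ n‖ ^ r) (hT : ∀ x, T x = ∑' n, (μ n * x' n x) • y n) :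
    (∃ (B : X →L[ℂ] ell2) (U : ell2 →L[ℂ] ell2) (A : ell2 →L[ℂ] Y),
      MemSchatten v U ∧ (∀ x, A (U (B x)) = T x) ∧
        ‖A‖ * schattenNorm v U * ‖B‖ ≤ (∑' n, ‖μ n‖ ^ r) ^ (1 / r)) ∧
      ‖T‖ ≤ (∑' n, ‖μ n‖ ^ r) ^ (1 / r) := by
  set S := ∑' n, ‖μ n‖ ^ r with hS
  have hS0 : 0 ≤ S := tsum_nonneg fun n => by positivity
  have ht : 0 ≤ 1 / r - 1 := sub_nonneg.2 (one_le_one_div hr0 hr1)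
  set C := S ^ (1 / 2 : ℝ) with hCdef
  have hC : 0 ≤ C := Real.rpow_nonneg hS0 _
  have hprod : C * S ^ (1 / r - 1) * C = S ^ (1 / r) := by
    rw [mul_right_comm, hCdef, ← Real.rpow_add_of_nonneg hS0 (by norm_num) (by norm_num),
      ← Real.rpow_add_of_nonneg hS0 (by norm_num) ht]
    ring_nf
  have hb : HasSum (fun n => (‖μ n‖ ^ (r / 2)) ^ (2 : ℝ)) (C ^ (2 : ℝ)) := by
    simp_rw [hCdef, ← Real.rpow_mul hS0, ← Real.rpow_mul (norm_nonneg _)]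
    simpa using hμ.hasSum
  obtain ⟨B, hB, hBx⟩ := exists_toEll2
    (φ := fun n => ((‖μ n‖ ^ (r / 2) : ℝ) : ℂ) • x' n) (fun n => by
      rw [norm_smul, Complex.norm_real, Real.norm_of_nonneg (by positivity)]
      exact mul_le_of_le_one_right (by positivity) (hx' n)) hC hb
  obtain ⟨A, hA, hAf⟩ := exists_ofEll2
    (z := fun n => (((‖μ n‖ ^ (r / 2) : ℝ) : ℂ) * (μ n / ‖μ n‖)) • y n) (fun n => by
      rw [norm_smul, norm_mul, norm_div, Complex.norm_real, Complex.norm_real, norm_norm,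
        Real.norm_of_nonneg (by positivity), mul_assoc]
      exact mul_le_of_le_one_right (by positivity)
        (mul_le_one₀ (div_self_le_one _) (norm_nonneg _) (hy n))) hC hb
  have hdnorm (n : ℕ) : ‖((‖μ n‖ ^ (1 - r) : ℝ) : ℂ)‖ = ‖μ n‖ ^ (1 - r) := by
    rw [Complex.norm_real, Real.norm_of_nonneg (by positivity)]
  have hd (n : ℕ) : ‖((‖μ n‖ ^ (1 - r) : ℝ) : ℂ)‖ ≤ S ^ (1 / r - 1) := by
    have h : ‖μ n‖ ^ r ≤ S := hμ.le_tsum n fun _ _ => by positivity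
    refine (hdnorm n).trans_le (le_trans (le_of_eq ?_) (Real.rpow_le_rpow (by positivity) h ht))
    rw [← Real.rpow_mul (norm_nonneg _)]
    congr 1
    field_simp
  obtain ⟨U, hU⟩ := exists_diagonal hd
  have hUnorm : ‖U‖ ≤ S ^ (1 / r - 1) := opNorm_le_of_diagonal hU (by positivity) hd
  have hfac (x : X) : A (U (B x)) = T x := by
    rw [hAf, hT]
    refine tsum_congr fun n => ?_
    rw [hU, hBx, smul_smul, smul_apply, smul_eq_mul]
    congr 1
    by_cases h0 : μ n = 0
    · simp [h0]
    · have hpos : 0 < ‖μ n‖ := norm_pos_iff.2 h0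
      have h : ‖μ n‖ ^ (1 - r) * ‖μ n‖ ^ (r / 2) * ‖μ n‖ ^ (r / 2) = ‖μ n‖ := by
        rw [← Real.rpow_add hpos, ← Real.rpow_add hpos]
        ring_nf
        exact Real.rpow_one _
      have hc : ((‖μ n‖ ^ (1 - r) : ℝ) : ℂ) * ((‖μ n‖ ^ (r / 2) : ℝ) : ℂ) *
          ((‖μ n‖ ^ (r / 2) : ℝ) : ℂ) = ‖μ n‖ := by exact_mod_cast h
      have hne : ((‖μ n‖ : ℝ) : ℂ) ≠ 0 := by exact_mod_cast hpos.ne'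
      calc _ = ((‖μ n‖ ^ (1 - r) : ℝ) : ℂ) * ((‖μ n‖ ^ (r / 2) : ℝ) : ℂ) *
            ((‖μ n‖ ^ (r / 2) : ℝ) : ℂ) * (μ n / ‖μ n‖) * x' n x := by ring
        _ = μ n * x' n x := by rw [hc, mul_div_cancel₀ _ hne]
  have hschatten : MemSchatten v U ∧ schattenNorm v U ≤ S ^ (1 / r - 1) := by
    by_cases hvtop : v = ∞
    · exact ⟨.inl hvtop, by rwa [schattenNorm, if_pos hvtop]⟩
    · have hvr : 1 / v.toReal = 1 / r - 1 := by
        rw [← ENNReal.toReal_ofReal ht, ← hv, ENNReal.toReal_div, ENNReal.toReal_one]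
      have hv0 : v ≠ 0 := by
        rintro rfl
        simp at hv
      have hvpos : 0 < v.toReal := ENNReal.toReal_pos hv0 hvtop
      have hexp : (1 - r) * v.toReal = r := by
        field_simp at hvr
        linarith
      have hpow (n : ℕ) : ‖((‖μ n‖ ^ (1 - r) : ℝ) : ℂ)‖ ^ v.toReal = ‖μ n‖ ^ r := by
        rw [hdnorm, ← Real.rpow_mul (norm_nonneg _), hexp]
      have h := schatten_of_diagonal hU hvpos (by simpa only [hpow] using hμ)
      simpa only [hpow, ← hS, hvr] using h
  refine ⟨⟨B, U, A, hschatten.1, hfac, ?_⟩, ?_⟩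
  · rw [← hprod]
    exact mul_le_mul (mul_le_mul hA hschatten.2 (schattenNorm_nonneg v U) hC) hB (norm_nonneg _)
      (by positivity)
  · have hTeq : T = A ∘L U ∘L B := by
      ext x
      exact (hfac x).symm
    rw [hTeq, ← hprod, mul_assoc]
    refine (A.opNorm_comp_le _).trans (mul_le_mul hA ((U.opNorm_comp_le B).trans ?_)
      (norm_nonneg _) hC)
    exact mul_le_mul hUnorm hB (norm_nonneg _) (by positivity)

/-- Let `0 < r ≤ 1` and `1/v = 1/r − 1` (`v = ∞` when `r = 1`).
Every `r`-nuclear operator `T : X → Y` between Banach spaces factors through an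
`S_v`-operator on a Hilbert space; moreover, for every `ε > 0` one can choose a
factorization `T = A ∘ U ∘ B` with `B : X → ℓ²`, `U ∈ S_v(ℓ²)`, `A : ℓ² → Y` and
`‖A‖ · σ_v(U) · ‖B‖ ≤ (1 + ε) · ν_r(T)`. -/
theorem rNuclear_factors_through_schatten
    {X Y : Type*} [NormedAddCommGroup X] [NormedSpace ℂ X] [CompleteSpace X]
    [NormedAddCommGroup Y] [NormedSpace ℂ Y] [CompleteSpace Y]
    (r : ℝ) (hr0 : 0 < r) (hr1 : r ≤ 1)
    (v : ℝ≥0∞) (hv : 1 / v = ENNReal.ofReal (1 / r - 1))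
    (T : X →L[ℂ] Y) (hT : RNuclear r T) :
    FactorsThroughSchatten v T ∧
    ∀ ε : ℝ, 0 < ε →
      ∃ (B : X →L[ℂ] ell2) (U : ell2 →L[ℂ] ell2) (A : ell2 →L[ℂ] Y),
        MemSchatten v U ∧ (∀ x, A (U (B x)) = T x) ∧
        ‖A‖ * schattenNorm v U * ‖B‖ ≤ (1 + ε) * nuclearNorm r T := by
  have hfactor : ∀ ε : ℝ, 0 < ε →
      ∃ (B : X →L[ℂ] ell2) (U : ell2 →L[ℂ] ell2) (A : ell2 →L[ℂ] Y),
        MemSchatten v U ∧ (∀ x, A (U (B x)) = T x) ∧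
        ‖A‖ * schattenNorm v U * ‖B‖ ≤ (1 + ε) * nuclearNorm r T := by
    intro ε hε
    have hlt {c : ℝ} (hc : nuclearNorm r T < c) :
        ∃ c' < c, (∃ (B : X →L[ℂ] ell2) (U : ell2 →L[ℂ] ell2) (A : ell2 →L[ℂ] Y),
          MemSchatten v U ∧ (∀ x, A (U (B x)) = T x) ∧
            ‖A‖ * schattenNorm v U * ‖B‖ ≤ c') ∧ ‖T‖ ≤ c' := by
      unfold nuclearNorm at hc
      obtain ⟨μ, x', y, hx', hy, hμ, hTx⟩ := hT
      obtain ⟨_, ⟨μ, x', y, hx', hy, hμ, hTx, rfl⟩, hc'⟩ :=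
        exists_lt_of_csInf_lt (by exact ⟨_, μ, x', y, hx', hy, hμ, hTx, rfl⟩) hc
      exact ⟨_, hc', exists_schatten_factorization hr0 hr1 hv hx' hy hμ hTx⟩
    have hnuc : ‖T‖ ≤ nuclearNorm r T := le_of_forall_gt_imp_ge_of_dense fun c hc => by
      obtain ⟨c', hc', -, hle⟩ := hlt hc
      exact hle.trans hc'.le
    rcases ((norm_nonneg T).trans hnuc).eq_or_lt with h0 | hpos
    · have hT0 : T = 0 := norm_le_zero_iff.1 (hnuc.trans h0.ge)
      obtain ⟨-, -, ⟨B, U, -, hU, -⟩, -⟩ := hlt (lt_add_one _)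
      exact ⟨B, U, 0, hU, fun x => by simp [hT0], by simp [← h0]⟩
    · obtain ⟨c', hc', ⟨B, U, A, hU, hfac, hle⟩, -⟩ :=
        hlt (lt_mul_of_one_lt_left hpos (lt_add_of_pos_right 1 hε))
      exact ⟨B, U, A, hU, hfac, hle.trans hc'.le⟩
  obtain ⟨B, U, A, hU, hfac, -⟩ := hfactor 1 one_pos
  exact ⟨⟨ell2, inferInstance, inferInstance, inferInstance, B, U, A, hU, hfac⟩, hfactor⟩
end
end

section
/- Let 0 < r ≤ 1 and 1/v = 1/r − 1. Every r-nuclear operator T : X → Y admits a factorization T = A∘Δ₀∘B in which B : X → ℓ² is 2-absolutely summing, Δ₀ is a diagonal operator on ℓ² belonging to S_v(ℓ²), and A : ℓ² → Y is a bounded operator whose adjoint A* : Y* → ℓ² is 2-absolutely summing. -/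
open scoped ENNReal NNReal ComplexConjugate
open MeasureTheory

noncomputable section

/-- A sequence of functionals that is pointwise square-summable with a uniform bound assembles
into a bounded operator into `ℓ²`. -/
theorem exists_clm_ell2_of_tsum_sq_le {E : Type*} [SeminormedAddCommGroup E] [NormedSpace ℂ E]
    (φ : ℕ → E →L[ℂ] ℂ) (C : ℝ) (hC : 0 ≤ C)
    (hs : ∀ x, Summable fun n => ‖φ n x‖ ^ 2)
    (hb : ∀ x, ∑' n, ‖φ n x‖ ^ 2 ≤ (C * ‖x‖) ^ 2) :
    ∃ B : E →L[ℂ] ell2, ∀ x n, B x n = φ n x := by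
  have hmem : ∀ x, Memℓp (fun n => φ n x) 2 := fun x => by
    refine memℓp_gen ?_
    simpa using hs x
  let L : E →ₗ[ℂ] ell2 :=
    { toFun := fun x => ⟨fun n => φ n x, hmem x⟩
      map_add' := fun x y => by ext n; exact map_add (φ n) x y
      map_smul' := fun c x => by ext n; simp }
  refine ⟨L.mkContinuous C fun x => ?_, fun x n => rfl⟩
  refine le_of_sq_le_sq ?_ (by positivity)
  have h := lp.norm_rpow_eq_tsum (p := 2) (by simp) (L x)
  simp only [ENNReal.toReal_ofNat, Real.rpow_ofNat] at h
  rw [h]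
  exact hb x

theorem ell2_norm_sq_eq_tsum (h : ell2) : ‖h‖ ^ 2 = ∑' n, ‖h n‖ ^ 2 := by
  simpa using lp.norm_rpow_eq_tsum (p := 2) (by simp) h

theorem ell2_summable_norm_sq (h : ell2) : Summable fun n => ‖h n‖ ^ 2 := by
  simpa using (lp.memℓp h).summable (by simp)

/-- The Cauchy–Schwarz inequality for absolutely convergent sums against an element of `ℓ²`. -/
theorem summable_mul_norm_and_tsum_le (a : ℕ → ℝ) (ha : ∀ n, 0 ≤ a n)
    (hs : Summable fun n => a n ^ 2) (h : ell2) :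
    (Summable fun n => a n * ‖h n‖) ∧
      ∑' n, a n * ‖h n‖ ≤ √(∑' n, a n ^ 2) * ‖h‖ := by
  have ha2 : Summable fun n => a n ^ (2 : ℝ) := by simpa using hs
  have hh2 : Summable fun n => ‖h n‖ ^ (2 : ℝ) := by simpa using ell2_summable_norm_sq h
  refine ⟨Real.summable_mul_of_Lp_Lq_of_nonneg Real.HolderConjugate.two_two ha
    (fun n => norm_nonneg (h n)) ha2 hh2, ?_⟩
  have key := Real.inner_le_Lp_mul_Lq_tsum_of_nonneg Real.HolderConjugate.two_two ha
    (fun n => norm_nonneg (h n)) ha2 hh2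
  simpa only [Real.rpow_ofNat, ← Real.sqrt_eq_rpow, ← ell2_norm_sq_eq_tsum,
    Real.sqrt_sq (norm_nonneg h)] using key

/-- A weighted `ℓ²` domination by contractive functionals forces 2-summability. -/
theorem absSumming_two_of_norm_sq_le_tsum {E F : Type*} [SeminormedAddCommGroup E]
    [NormedSpace ℂ E] [SeminormedAddCommGroup F] [NormedSpace ℂ F] (U : E →L[ℂ] F)
    (a : ℕ → ℝ) (ha : ∀ n, 0 ≤ a n) (hs : Summable a) (φ : ℕ → E →L[ℂ] ℂ)
    (hφ : ∀ n, ‖φ n‖ ≤ 1) (hU : ∀ x, ‖U x‖ ^ 2 ≤ ∑' n, a n * ‖φ n x‖ ^ 2) :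
    AbsSumming 2 U := by
  have hS : 0 ≤ ∑' n, a n := tsum_nonneg ha
  refine ⟨√(1 + ∑' n, a n), Real.sqrt_pos.2 (by linarith), fun N x b hb => ?_⟩
  simp only [Real.rpow_ofNat] at hb ⊢
  rw [Real.sq_sqrt (by linarith)]
  have hb0 : 0 ≤ b := by simpa using hb 0 (by simp)
  have hsum : ∀ k, Summable fun n => a n * ‖φ n (x k)‖ ^ 2 := fun k => by
    refine Summable.of_nonneg_of_le (fun n => mul_nonneg (ha n) (by positivity))
      (fun n => ?_) (hs.mul_right (‖x k‖ ^ 2))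
    have : ‖φ n (x k)‖ ≤ ‖x k‖ := by simpa using (φ n).le_of_opNorm_le (hφ n) (x k)
    have := ha n
    gcongr
  calc ∑ k, ‖U (x k)‖ ^ 2 ≤ ∑ k, ∑' n, a n * ‖φ n (x k)‖ ^ 2 :=
        Finset.sum_le_sum fun k _ => hU (x k)
    _ = ∑' n, ∑ k, a n * ‖φ n (x k)‖ ^ 2 :=
        (Summable.tsum_finsetSum fun k _ => hsum k).symm
    _ ≤ ∑' n, a n * b := by
        refine Summable.tsum_le_tsum (fun n => ?_) (summable_sum fun k _ => hsum k)
          (hs.mul_right b)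
        rw [← Finset.mul_sum]
        exact mul_le_mul_of_nonneg_left (hb (φ n) (hφ n)) (ha n)
    _ = (∑' n, a n) * b := tsum_mul_right
    _ ≤ (1 + ∑' n, a n) * b := by nlinarith

/-- The weighted analysis operator `x ↦ (wₙ x'ₙ(x))` into `ℓ²` is 2-summing. -/
theorem exists_absSumming_analysis {E : Type*} [SeminormedAddCommGroup E] [NormedSpace ℂ E]
    (w : ℕ → ℝ) (hw : Summable fun n => w n ^ 2) (φ : ℕ → E →L[ℂ] ℂ) (hφ : ∀ n, ‖φ n‖ ≤ 1) :
    ∃ B : E →L[ℂ] ell2, (∀ x n, B x n = w n * φ n x) ∧ AbsSumming 2 B := by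
  have hle : ∀ x n, w n ^ 2 * ‖φ n x‖ ^ 2 ≤ w n ^ 2 * ‖x‖ ^ 2 := fun x n => by
    have : ‖φ n x‖ ≤ ‖x‖ := by simpa using (φ n).le_of_opNorm_le (hφ n) x
    gcongr
  have hsum : ∀ x, Summable fun n => w n ^ 2 * ‖φ n x‖ ^ 2 := fun x =>
    Summable.of_nonneg_of_le (fun n => by positivity) (hle x) (hw.mul_right _)
  have heq : ∀ x n, ‖((w n : ℂ) • φ n) x‖ ^ 2 = w n ^ 2 * ‖φ n x‖ ^ 2 := fun x n => by
    simp [mul_pow]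
  obtain ⟨B, hB⟩ := exists_clm_ell2_of_tsum_sq_le (fun n => (w n : ℂ) • φ n)
    (√(∑' n, w n ^ 2)) (Real.sqrt_nonneg _) (fun x => by simpa only [heq] using hsum x)
    (fun x => by
      simp only [heq]
      rw [mul_pow, Real.sq_sqrt (tsum_nonneg fun n => sq_nonneg _), ← tsum_mul_right]
      exact Summable.tsum_le_tsum (hle x) (hsum x) (hw.mul_right _))
  refine ⟨B, fun x n => by simp [hB], ?_⟩
  refine absSumming_two_of_norm_sq_le_tsum B (fun n => w n ^ 2) (fun n => sq_nonneg _) hw φ hφ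
    fun x => ?_
  rw [ell2_norm_sq_eq_tsum]
  simp only [hB, heq, le_refl]

/-- The weighted synthesis operator `h ↦ ∑ wₙ hₙ yₙ` on `ℓ²` has a 2-summing adjoint. -/
theorem exists_synthesis_with_absSumming_adjoint {F : Type*} [NormedAddCommGroup F]
    [NormedSpace ℂ F] [CompleteSpace F] (w : ℕ → ℝ) (hw0 : ∀ n, 0 ≤ w n)
    (hw : Summable fun n => w n ^ 2) (y : ℕ → F) (hy : ∀ n, ‖y n‖ ≤ 1) :
    ∃ A : ell2 →L[ℂ] F, (∀ h : ell2, A h = ∑' n, ((w n : ℂ) * h n) • y n) ∧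
      ∃ A' : (F →L[ℂ] ℂ) →L[ℂ] (ell2 →L[ℂ] ℂ),
        (∀ (y' : F →L[ℂ] ℂ) (h : ell2), A' y' h = y' (A h)) ∧ AbsSumming 2 A' := by
  have hle : ∀ (h : ell2) n, ‖((w n : ℂ) * h n) • y n‖ ≤ w n * ‖h n‖ := fun h n => by
    rw [norm_smul, norm_mul, Complex.norm_real, Real.norm_of_nonneg (hw0 n)]
    exact mul_le_of_le_one_right (mul_nonneg (hw0 n) (norm_nonneg _)) (hy n)
  have hcs := summable_mul_norm_and_tsum_le w hw0 hw
  have hsum : ∀ h : ell2, Summable fun n => ((w n : ℂ) * h n) • y n := fun h =>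
    Summable.of_norm_bounded (hcs h).1 (hle h)
  let L : ell2 →ₗ[ℂ] F :=
    { toFun := fun h => ∑' n, ((w n : ℂ) * h n) • y n
      map_add' := fun g h => by
        rw [← (hsum g).tsum_add (hsum h)]
        simp [mul_add, add_smul]
      map_smul' := fun c h => by
        rw [RingHom.id_apply, ← (hsum h).tsum_const_smul c]
        simp [smul_smul, mul_left_comm] }
  let A : ell2 →L[ℂ] F := L.mkContinuous (√(∑' n, w n ^ 2)) fun h =>
    (tsum_of_norm_bounded (hcs h).1.hasSum (hle h)).trans (hcs h).2
  have hA : ∀ h : ell2, A h = ∑' n, ((w n : ℂ) * h n) • y n := fun h => rfl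
  refine ⟨A, hA, (ContinuousLinearMap.compL ℂ ell2 F ℂ).flip A, fun y' h => rfl, ?_⟩
  refine absSumming_two_of_norm_sq_le_tsum _ (fun n => w n ^ 2) (fun n => sq_nonneg _) hw
    (fun n => NormedSpace.inclusionInDoubleDual ℂ F (y n))
    (fun n => (NormedSpace.double_dual_bound ℂ F (y n)).trans (hy n)) fun y' => ?_
  have hs : Summable fun n => (w n * ‖y' (y n)‖) ^ 2 := by
    refine Summable.of_nonneg_of_le (fun n => by positivity) (fun n => ?_)
      (hw.mul_right (‖y'‖ ^ 2))
    have : ‖y' (y n)‖ ≤ ‖y'‖ := y'.unit_le_opNorm (y n) (hy n)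
    rw [mul_pow]
    gcongr
  have hcs' := summable_mul_norm_and_tsum_le (fun n => w n * ‖y' (y n)‖)
    (fun n => mul_nonneg (hw0 n) (norm_nonneg _)) hs
  have hbound : ‖(ContinuousLinearMap.compL ℂ ell2 F ℂ).flip A y'‖ ≤
      √(∑' n, (w n * ‖y' (y n)‖) ^ 2) := by
    refine ContinuousLinearMap.opNorm_le_bound _ (Real.sqrt_nonneg _) fun h => ?_
    have happ : (ContinuousLinearMap.compL ℂ ell2 F ℂ).flip A y' h =
        ∑' n, y' (((w n : ℂ) * h n) • y n) := y'.map_tsum (hsum h)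
    rw [happ]
    refine (tsum_of_norm_bounded (hcs' h).1.hasSum fun n => ?_).trans (hcs' h).2
    rw [map_smul, norm_smul, norm_mul, Complex.norm_real, Real.norm_of_nonneg (hw0 n)]
    exact le_of_eq (by ring)
  refine (pow_le_pow_left₀ (norm_nonneg _) hbound 2).trans (le_of_eq ?_)
  rw [Real.sq_sqrt (tsum_nonneg fun n => sq_nonneg _)]
  simp [mul_pow]

/-- A bounded sequence defines a diagonal operator on `ℓ²`. -/
theorem exists_diagonal_ell2 (d : ℕ → ℂ) (M : ℝ) (hM : ∀ n, ‖d n‖ ≤ M) :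
    ∃ D : ell2 →L[ℂ] ell2, ∀ (x : ell2) (n : ℕ), D x n = d n * x n := by
  have hM0 : 0 ≤ M := (norm_nonneg _).trans (hM 0)
  have heval : ∀ (x : ell2) n, (d n • lp.evalCLM ℂ (fun _ : ℕ => ℂ) 2 n) x = d n * x n :=
    fun x n => rfl
  have hle : ∀ (x : ell2) n, ‖(d n • lp.evalCLM ℂ (fun _ : ℕ => ℂ) 2 n) x‖ ^ 2 ≤
      M ^ 2 * ‖x n‖ ^ 2 := fun x n => by
    have := hM n
    rw [heval, norm_mul, mul_pow]
    gcongr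
  have hs := fun x : ell2 => (ell2_summable_norm_sq x).mul_left (M ^ 2)
  have hs' := fun x : ell2 =>
    Summable.of_nonneg_of_le (fun n => sq_nonneg _) (hle x) (hs x)
  obtain ⟨D, hD⟩ := exists_clm_ell2_of_tsum_sq_le
    (fun n => d n • lp.evalCLM ℂ (fun _ : ℕ => ℂ) 2 n) M hM0 hs' (fun x => by
      rw [mul_pow, ell2_norm_sq_eq_tsum, ← tsum_mul_left]
      exact Summable.tsum_le_tsum (hle x) (hs' x) (hs x))
  exact ⟨D, fun x n => (hD x n).trans (heval x n)⟩

/-- Let `0 < r ≤ 1` and `1/v = 1/r − 1` (`v = ∞` when `r = 1`).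
Every `r`-nuclear operator `T : X → Y` admits a factorization `T = A ∘ Δ₀ ∘ B` in which
`B : X → ℓ²` is 2-absolutely summing, `Δ₀` is a diagonal operator on `ℓ²` whose diagonal
lies in `ℓ^v` (i.e. `Δ₀ ∈ S_v(ℓ²)`), and `A : ℓ² → Y` is a bounded operator whose adjoint
`A* : Y* → ℓ²* = ℓ²` is 2-absolutely summing. -/
theorem rNuclear_factors_summing_diagonal_summing
    {X Y : Type*} [NormedAddCommGroup X] [NormedSpace ℂ X] [CompleteSpace X]
    [NormedAddCommGroup Y] [NormedSpace ℂ Y] [CompleteSpace Y]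
    (r : ℝ) (hr0 : 0 < r) (hr1 : r ≤ 1)
    (v : ℝ≥0∞) (hv : 1 / v = ENNReal.ofReal (1 / r - 1))
    (T : X →L[ℂ] Y) (hT : RNuclear r T) :
    ∃ (B : X →L[ℂ] ell2) (d : ℕ → ℂ) (Δ₀ : ell2 →L[ℂ] ell2) (A : ell2 →L[ℂ] Y),
      (∀ x, A (Δ₀ (B x)) = T x) ∧
      AbsSumming 2 B ∧
      (∀ (x : ell2) (n : ℕ), Δ₀ x n = d n * x n) ∧
      (v = ∞ ∨ Summable fun n => ‖d n‖ ^ v.toReal) ∧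
      ∃ A' : (Y →L[ℂ] ℂ) →L[ℂ] (ell2 →L[ℂ] ℂ),
        (∀ (y' : Y →L[ℂ] ℂ) (h : ell2), A' y' h = y' (A h)) ∧ AbsSumming 2 A' := by
  obtain ⟨μ, x', y, hx', hy, hμ, hT⟩ := hT
  set w : ℕ → ℝ := fun n => ‖μ n‖ ^ (r / 2) with hw_def
  have hw0 : ∀ n, 0 ≤ w n := fun n => by positivity
  have hw2 : ∀ n, w n ^ 2 = ‖μ n‖ ^ r := fun n => by
    rw [hw_def, ← Real.rpow_mul_natCast (norm_nonneg _)]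
    norm_num
  have hw : Summable fun n => w n ^ 2 := by simpa only [hw2] using hμ
  set d : ℕ → ℂ := fun n => μ n / ((w n : ℂ) ^ 2) with hd_def
  have hdw : ∀ n, (w n : ℂ) * (d n * (w n)) = μ n := fun n => by
    rcases eq_or_ne (μ n) 0 with h | h
    · simp [hd_def, h]
    · have : (w n : ℂ) ≠ 0 := by
        simpa [hw_def] using (Real.rpow_pos_of_pos (norm_pos_iff.2 h) (r / 2)).ne'
      simp only [hd_def]
      field_simp
  have hd : ∀ n, ‖d n‖ = ‖μ n‖ / ‖μ n‖ ^ r := fun n => by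
    rw [← hw2]
    simp [hd_def]
  have hd' : ∀ n, ‖d n‖ ≤ (∑' k, ‖μ k‖ ^ r) ^ ((1 - r) / r) := fun n => by
    rcases eq_or_ne (μ n) 0 with h | h
    · rw [hd, h]
      simp only [norm_zero, zero_div]
      exact Real.rpow_nonneg (tsum_nonneg fun k => by positivity) _
    · have hp := norm_pos_iff.2 h
      have : ‖d n‖ = (‖μ n‖ ^ r) ^ ((1 - r) / r) := by
        rw [hd, ← Real.rpow_mul hp.le, mul_div_cancel₀ _ hr0.ne', Real.rpow_sub hp,
          Real.rpow_one]
      rw [this]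
      exact Real.rpow_le_rpow (by positivity)
        (hμ.le_tsum n fun k _ => by positivity) (div_nonneg (by linarith) hr0.le)
  obtain ⟨B, hB, hB2⟩ := exists_absSumming_analysis w hw x' hx'
  obtain ⟨A, hA, hA2⟩ := exists_synthesis_with_absSumming_adjoint w hw0 hw y hy
  obtain ⟨D, hD⟩ := exists_diagonal_ell2 d _ hd'
  refine ⟨B, d, D, A, fun x => ?_, hB2, hD, ?_, hA2⟩
  · rw [hA, hT]
    refine tsum_congr fun n => ?_
    rw [hD, hB, ← hdw n]
    ring_nf
  · rw [or_iff_not_imp_left]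
    intro hvtop
    have hv' : v.toReal⁻¹ = 1 / r - 1 := by
      have h1 : 0 ≤ 1 / r - 1 := by
        rw [sub_nonneg, le_div_iff₀ hr0]
        linarith
      rw [← ENNReal.toReal_inv, ← one_div, hv, ENNReal.toReal_ofReal h1]
    have hv0 : v ≠ 0 := by
      rintro rfl
      simp at hv
    have hvpos : 0 < v.toReal := ENNReal.toReal_pos hv0 hvtop
    have hexp : (1 - r) * v.toReal = r := by
      have h : 1 - r = r * v.toReal⁻¹ := by
        rw [hv']
        field_simp
      rw [h, mul_assoc, inv_mul_cancel₀ hvpos.ne', mul_one]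
    refine hμ.congr fun n => ?_
    rcases eq_or_ne (μ n) 0 with h | h
    · rw [hd, h]
      simp [Real.zero_rpow hr0.ne', Real.zero_rpow hvpos.ne']
    · have hp := norm_pos_iff.2 h
      have : ‖d n‖ = ‖μ n‖ ^ (1 - r) := by rw [hd, Real.rpow_sub hp, Real.rpow_one]
      rw [this, ← Real.rpow_mul hp.le, hexp]

end
end

section
/- There exist Banach spaces Z and W and nuclear operators t₁ : Z → W and t₂ : W → Z such that the eigenvalue sequence of the product t₂∘t₁ : Z → Z belongs to ℓ_1 but does not belong to the Lorentz space ℓ_{1,s} for any s < 1. -/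
open scoped ENNReal NNReal ComplexConjugate
open MeasureTheory

noncomputable section

/-- The algebraic multiplicity of `μ` as an eigenvalue of `S`: the dimension of the
generalized eigenspace `⋃_k ker (S - μ)^k`. -/
def algebraicMultiplicity {Z : Type*} [NormedAddCommGroup Z] [NormedSpace ℂ Z]
    (S : Z →L[ℂ] Z) (μ : ℂ) : ℕ :=
  Module.finrank ℂ
    ↥(⨆ k : ℕ, LinearMap.ker ((((S - μ • (1 : Z →L[ℂ] Z)) ^ k : Z →L[ℂ] Z)) : Z →ₗ[ℂ] Z))

/-- `lam` is (an enumeration of) the eigenvalue sequence of `S`: the sequence of all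
(nonzero) eigenvalues of `S`, each counted according to its algebraic multiplicity
(entries equal to `0` serve as padding). -/
def IsEigenvalueSeq {Z : Type*} [NormedAddCommGroup Z] [NormedSpace ℂ Z]
    (S : Z →L[ℂ] Z) (lam : ℕ → ℂ) : Prop :=
  (∀ n, lam n ≠ 0 → ∃ x : Z, x ≠ 0 ∧ S x = lam n • x) ∧
  (∀ μ : ℂ, μ ≠ 0 → Nat.card {n : ℕ // lam n = μ} = algebraicMultiplicity S μ)

end

noncomputable section

/-- The `n`-th approximation number of a family `x : I → ℂ`
(`a_n(x) = inf { c ≥ 0 : card { i : |x_i| ≥ c } < n }`), i.e. the `n`-th term of the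
nonincreasing rearrangement of `x` (indexed from `n = 1`). -/
def seqApproxNum {I : Type*} (x : I → ℂ) (n : ℕ) : ℝ :=
  sInf { c : ℝ | 0 ≤ c ∧ { i : I | c ≤ ‖x i‖ }.Finite ∧
    Nat.card { i : I | c ≤ ‖x i‖ } < n }

/-- Membership in the Lorentz sequence space `ℓ_{p,q}(I)`: the family is bounded and its
nonincreasing rearrangement `(a_n(x))_{n≥1}` satisfies `Σ_n n^{q/p−1} a_n(x)^q < ∞`. -/
def MemLorentzSeq {I : Type*} (p q : ℝ) (x : I → ℂ) : Prop :=
  BddAbove (Set.range fun i => ‖x i‖) ∧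
  Summable fun n : ℕ => ((n : ℝ) + 1) ^ (q / p - 1) * seqApproxNum x (n + 1) ^ q

end

noncomputable section

section NuclearSums

variable {ι X Y : Type*} [NormedAddCommGroup X] [NormedSpace ℂ X]
  [NormedAddCommGroup Y] [NormedSpace ℂ Y]

/-- The operator `x ↦ Σ_i μ_i ⟨x'_i, x⟩ y_i`, as a sum in operator norm. -/
def nuclearSum (μ : ι → ℂ) (x' : ι → X →L[ℂ] ℂ) (y : ι → Y) : X →L[ℂ] Y :=
  ∑' i, μ i • (x' i).smulRight (y i)

lemma hasSum_nuclearSum_apply [CompleteSpace Y] {μ : ι → ℂ} {x' : ι → X →L[ℂ] ℂ} {y : ι → Y}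
    (hx' : ∀ i, ‖x' i‖ ≤ 1) (hy : ∀ i, ‖y i‖ ≤ 1) (hμ : Summable fun i => ‖μ i‖) (x : X) :
    HasSum (fun i => (μ i * x' i x) • y i) (nuclearSum μ x' y x) := by
  have hs : Summable fun i => μ i • (x' i).smulRight (y i) := by
    refine Summable.of_norm_bounded hμ fun i => ?_
    rw [norm_smul, ContinuousLinearMap.norm_smulRight_apply]
    exact mul_le_of_le_one_right (norm_nonneg _) (mul_le_one₀ (hx' i) (norm_nonneg _) (hy i))
  have h := hs.hasSum.mapL (ContinuousLinearMap.apply ℂ Y x)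
  simpa [nuclearSum, mul_smul] using h

lemma rNuclear_nuclearSum [Countable ι] [Infinite ι] [CompleteSpace Y]
    {μ : ι → ℂ} {x' : ι → X →L[ℂ] ℂ} {y : ι → Y}
    (hx' : ∀ i, ‖x' i‖ ≤ 1) (hy : ∀ i, ‖y i‖ ≤ 1) (hμ : Summable fun i => ‖μ i‖) :
    RNuclear 1 (nuclearSum μ x' y) := by
  obtain ⟨_⟩ := nonempty_denumerable ι
  let e : ℕ ≃ ι := (Denumerable.eqv ι).symm
  refine ⟨μ ∘ e, x' ∘ e, y ∘ e, fun n => hx' _, fun n => hy _, ?_, fun x => ?_⟩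
  · simpa [Function.comp_def] using e.summable_iff.2 hμ
  · exact (e.hasSum_iff.2 (hasSum_nuclearSum_apply hx' hy hμ x)).tsum_eq.symm

end NuclearSums

/-- Orthogonality of the characters of `ℤ / Nℤ`. -/
lemma sum_pow_mul_conj_pow {N : ℕ} {ζ : ℂ} (hζ : IsPrimitiveRoot ζ N) {m n : ℕ}
    (hm : m < N) (hn : n < N) :
    ∑ j : Fin N, (ζ ^ m) ^ (j : ℕ) * conj ((ζ ^ n) ^ (j : ℕ)) = if m = n then (N : ℂ) else 0 := by
  have hN : N ≠ 0 := by omega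
  have hconj : conj ζ = ζ⁻¹ := (Complex.inv_eq_conj (hζ.norm'_eq_one hN)).symm
  have h0 : ζ ≠ 0 := hζ.ne_zero hN
  rw [Fin.sum_univ_eq_sum_range (fun j => (ζ ^ m) ^ j * conj ((ζ ^ n) ^ j)) N]
  have h1 : ∀ j, (ζ ^ m) ^ j * conj ((ζ ^ n) ^ j) = (ζ ^ m / ζ ^ n) ^ j := by
    intro j
    simp [map_pow, hconj, div_eq_mul_inv, mul_pow]
  simp only [h1]
  split_ifs with h
  · subst h
    simp [h0]
  · have hne : ζ ^ m / ζ ^ n ≠ 1 := fun h' =>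
      h (hζ.pow_inj hm hn ((div_eq_one_iff_eq (pow_ne_zero _ h0)).1 h'))
    have hg := mul_geom_sum (ζ ^ m / ζ ^ n) N
    have : (ζ ^ m / ζ ^ n) ^ N = 1 := by
      rw [div_pow, ← pow_mul, ← pow_mul, mul_comm m, mul_comm n, pow_mul, pow_mul, hζ.pow_eq_one]
      simp
    rw [this, sub_self] at hg
    exact (mul_eq_zero.1 hg).resolve_left (sub_ne_zero.2 hne)

/-- The primitive `(k+1)`-st root of unity `exp (2πi / (k+1))`. -/
def unityRoot (k : ℕ) : ℂ := Complex.exp (2 * Real.pi * Complex.I / ((k + 1 : ℕ) : ℂ))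

lemma isPrimitiveRoot_unityRoot (k : ℕ) : IsPrimitiveRoot (unityRoot k) (k + 1) :=
  Complex.isPrimitiveRoot_exp (k + 1) k.succ_ne_zero

lemma norm_unityRoot (k : ℕ) : ‖unityRoot k‖ = 1 :=
  (isPrimitiveRoot_unityRoot k).norm'_eq_one k.succ_ne_zero

/-- The space `ℓ¹` over `ℕ`. -/
abbrev ell1 : Type := lp (fun _ : ℕ => ℂ) 1

/-- The space `ℓ^∞` over `ℕ`. -/
abbrev ellInfty : Type := lp (fun _ : ℕ => ℂ) ∞

lemma evalCLM_apply {p : ℝ≥0∞} [Fact (1 ≤ p)] (m : ℕ) (x : lp (fun _ : ℕ => ℂ) p) :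
    lp.evalCLM ℂ (fun _ : ℕ => ℂ) p m x = x m := rfl

/-- The functional on `ℓ¹` given by a truncated character. -/
def charFunctional (p : Σ k : ℕ, Fin (k + 1)) : ell1 →L[ℂ] ℂ :=
  ∑ m ∈ Finset.range (p.1 + 1),
    (unityRoot p.1 ^ m) ^ (p.2 : ℕ) • lp.evalCLM ℂ (fun _ : ℕ => ℂ) 1 m

lemma norm_charFunctional_le (p : Σ k : ℕ, Fin (k + 1)) : ‖charFunctional p‖ ≤ 1 := by
  refine ContinuousLinearMap.opNorm_le_bound _ zero_le_one fun x => ?_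
  rw [one_mul]
  have h := lp.sum_rpow_le_norm_rpow (p := 1) (by simp) x (Finset.range (p.1 + 1))
  simp only [ENNReal.toReal_one, Real.rpow_one] at h
  refine le_trans ?_ h
  simp only [charFunctional, sum_apply]
  refine (norm_sum_le _ _).trans (Finset.sum_le_sum fun m _ => ?_)
  simp [norm_unityRoot, evalCLM_apply]

lemma charFunctional_single (p : Σ k : ℕ, Fin (k + 1)) (m : ℕ) :
    charFunctional p (lp.single 1 m 1) =
      if m ≤ p.1 then (unityRoot p.1 ^ m) ^ (p.2 : ℕ) else 0 := by
  simp [charFunctional, sum_apply, evalCLM_apply, Pi.single_apply]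

/-- The conjugate of a truncated character, as an element of `ℓ^∞`. -/
def charVector (p : Σ k : ℕ, Fin (k + 1)) : ellInfty :=
  ⟨fun n => if n ≤ p.1 then conj ((unityRoot p.1 ^ n) ^ (p.2 : ℕ)) else 0, by
    refine memℓp_infty ⟨1, ?_⟩
    rintro _ ⟨n, rfl⟩
    dsimp only
    split_ifs <;> simp [norm_unityRoot]⟩

lemma charVector_apply (p : Σ k : ℕ, Fin (k + 1)) (n : ℕ) :
    charVector p n = if n ≤ p.1 then conj ((unityRoot p.1 ^ n) ^ (p.2 : ℕ)) else 0 := rfl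

lemma norm_charVector_le (p : Σ k : ℕ, Fin (k + 1)) : ‖charVector p‖ ≤ 1 := by
  refine lp.norm_le_of_forall_le zero_le_one fun n => ?_
  rw [charVector_apply]
  split_ifs <;> simp [norm_unityRoot]

lemma hasSum_indicator_sub_succ {β : ℕ → ℝ} (hβ : Antitone β)
    (h0 : Filter.Tendsto β Filter.atTop (nhds 0)) (m : ℕ) :
    HasSum (fun k => if m ≤ k then β k - β (k + 1) else 0) (β m) := by
  rw [hasSum_iff_tendsto_nat_of_nonneg]
  · have h : ∀ N, m ≤ N →
        ∑ k ∈ Finset.range N, (if m ≤ k then β k - β (k + 1) else 0) = β m - β N := by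
      intro N hN
      induction N, hN using Nat.le_induction with
      | base =>
        rw [sub_self]
        exact Finset.sum_eq_zero fun k hk => if_neg (not_le.2 (Finset.mem_range.1 hk))
      | succ N hN ih => rw [Finset.sum_range_succ, ih, if_pos hN]; ring
    have h1 : Filter.Tendsto (fun N => β m - β N) Filter.atTop (nhds (β m)) := by
      simpa using tendsto_const_nhds.sub h0
    refine h1.congr' ?_
    filter_upwards [Filter.eventually_ge_atTop m] with N hN using (h N hN).symm
  · intro k
    split_ifs
    · exact sub_nonneg.2 (hβ k.le_succ)
    · exact le_rfl

/-- The weights of the nuclear representation of a diagonal operator `ℓ¹ → ℓ^∞`. -/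
def charWeight (β : ℕ → ℝ) (p : Σ k : ℕ, Fin (k + 1)) : ℂ :=
  (((β p.1 - β (p.1 + 1)) / (p.1 + 1) : ℝ) : ℂ)

lemma summable_norm_charWeight {β : ℕ → ℝ} (hβ : Antitone β)
    (h0 : Filter.Tendsto β Filter.atTop (nhds 0)) : Summable fun p => ‖charWeight β p‖ := by
  rw [summable_sigma_of_nonneg fun _ => norm_nonneg _]
  refine ⟨fun k => Summable.of_finite, ?_⟩
  convert (hasSum_indicator_sub_succ hβ h0 0).summable using 2 with k
  have hk : (0 : ℝ) < (k : ℝ) + 1 := by positivity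
  have hd : 0 ≤ β k - β (k + 1) := sub_nonneg.2 (hβ k.le_succ)
  rw [tsum_fintype]
  simp only [charWeight, Complex.norm_real, Real.norm_eq_abs, abs_of_nonneg (div_nonneg hd hk.le)]
  simp
  field_simp

/-- The diagonal operator `ℓ¹ → ℓ^∞` with diagonal `β`. -/
def diagOneInfty (β : ℕ → ℝ) : ell1 →L[ℂ] ellInfty :=
  nuclearSum (charWeight β) charFunctional charVector

lemma rNuclear_diagOneInfty {β : ℕ → ℝ} (hβ : Antitone β)
    (h0 : Filter.Tendsto β Filter.atTop (nhds 0)) : RNuclear 1 (diagOneInfty β) :=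
  rNuclear_nuclearSum norm_charFunctional_le norm_charVector_le (summable_norm_charWeight hβ h0)

lemma diagOneInfty_single {β : ℕ → ℝ} (hβ : Antitone β)
    (h0 : Filter.Tendsto β Filter.atTop (nhds 0)) (m n : ℕ) :
    diagOneInfty β (lp.single 1 m 1) n = if n = m then (β m : ℂ) else 0 := by
  have h := (hasSum_nuclearSum_apply norm_charFunctional_le norm_charVector_le
    (summable_norm_charWeight hβ h0) (lp.single 1 m 1)).mapL
      (lp.evalCLM ℂ (fun _ : ℕ => ℂ) ∞ n)
  have h2 := h.sigma (g := fun k => if m ≤ k ∧ n = m then ((β k - β (k + 1) : ℝ) : ℂ) else 0)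
    fun k => by
      convert! hasSum_fintype _ using 1
      have hk : ((k : ℂ) + 1) ≠ 0 := by exact_mod_cast k.succ_ne_zero
      have hrw : ∀ j : Fin (k + 1), lp.evalCLM ℂ (fun _ : ℕ => ℂ) ∞ n
          ((charWeight β ⟨k, j⟩ * charFunctional ⟨k, j⟩ (lp.single 1 m 1)) • charVector ⟨k, j⟩) =
          (charWeight β ⟨k, 0⟩) * (if m ≤ k ∧ n ≤ k then
            (unityRoot k ^ m) ^ (j : ℕ) * conj ((unityRoot k ^ n) ^ (j : ℕ)) else 0) := by
        intro j
        rw [charFunctional_single, map_smul]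
        change _ • charVector ⟨k, j⟩ n = _
        rw [charVector_apply]
        by_cases h1 : m ≤ k <;> by_cases h2 : n ≤ k <;> simp [h1, h2, charWeight, mul_assoc]
      simp only [hrw]
      rw [← Finset.mul_sum]
      by_cases h12 : m ≤ k ∧ n ≤ k
      · simp only [h12, and_self, if_true, true_and]
        rw [sum_pow_mul_conj_pow (isPrimitiveRoot_unityRoot k) (by omega) (by omega)]
        by_cases h : n = m
        · simp [h, charWeight]
          field_simp
        · simp [h, Ne.symm h]
      · rw [if_neg (by omega)]
        simp [h12]
  change HasSum _ (diagOneInfty β (lp.single 1 m 1) n) at h2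
  refine h2.unique ?_
  split_ifs with hnm
  · have := Complex.hasSum_ofReal.2 (hasSum_indicator_sub_succ hβ h0 m)
    convert this using 2 with k
    by_cases hk : m ≤ k <;> simp [hk, hnm]
  · simp [hnm]

/-- The diagonal operator `ℓ^∞ → ℓ¹` with summable diagonal `δ`. -/
def diagInftyOne (δ : ℕ → ℝ) : ellInfty →L[ℂ] ell1 :=
  nuclearSum (fun n => (δ n : ℂ)) (fun n => lp.evalCLM ℂ (fun _ : ℕ => ℂ) ∞ n)
    (fun n => lp.single 1 n 1)

lemma norm_evalCLM_infty_le (n : ℕ) : ‖lp.evalCLM ℂ (fun _ : ℕ => ℂ) ∞ n‖ ≤ 1 := by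
  refine ContinuousLinearMap.opNorm_le_bound _ zero_le_one fun x => ?_
  rw [one_mul]
  exact lp.norm_apply_le_norm (by simp) x n

lemma norm_single_one_le (n : ℕ) : ‖(lp.single 1 n 1 : ell1)‖ ≤ 1 := by
  rw [lp.norm_single (by simp)]; simp

lemma rNuclear_diagInftyOne {δ : ℕ → ℝ} (hδ : Summable δ) : RNuclear 1 (diagInftyOne δ) :=
  rNuclear_nuclearSum norm_evalCLM_infty_le norm_single_one_le (by simpa using hδ.norm)

lemma diagInftyOne_apply {δ : ℕ → ℝ} (hδ : Summable δ) (y : ellInfty) (n : ℕ) :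
    diagInftyOne δ y n = δ n * y n := by
  have h := (hasSum_nuclearSum_apply norm_evalCLM_infty_le norm_single_one_le
    (by simpa using hδ.norm : Summable fun n => ‖(δ n : ℂ)‖) y).mapL
      (lp.evalCLM ℂ (fun _ : ℕ => ℂ) 1 n)
  change HasSum _ (diagInftyOne δ y n) at h
  refine h.unique ?_
  have key : ∀ k, lp.evalCLM ℂ (fun _ : ℕ => ℂ) 1 n
      (((δ k : ℂ) * lp.evalCLM ℂ (fun _ : ℕ => ℂ) ∞ k y) • lp.single 1 k 1) =
      if k = n then (δ n : ℂ) * y n else 0 := by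
    intro k
    split_ifs with hk
    · subst hk; simp [evalCLM_apply]
    · simp [evalCLM_apply, Ne.symm hk]
  simp only [key]
  exact hasSum_ite_eq n _

lemma diagInftyOne_comp_diagOneInfty_apply {β δ : ℕ → ℝ} (hβ : Antitone β)
    (h0 : Filter.Tendsto β Filter.atTop (nhds 0)) (hδ : Summable δ) (x : ell1) (n : ℕ) :
    ((diagInftyOne δ).comp (diagOneInfty β)) x n = ((β n * δ n : ℝ) : ℂ) * x n := by
  have h := (lp.hasSum_single (by simp) x).mapL
    ((lp.evalCLM ℂ (fun _ : ℕ => ℂ) 1 n).comp ((diagInftyOne δ).comp (diagOneInfty β)))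
  refine h.unique ?_
  have key : ∀ m, ((lp.evalCLM ℂ (fun _ : ℕ => ℂ) 1 n).comp
      ((diagInftyOne δ).comp (diagOneInfty β))) (lp.single 1 m (x m)) =
      if m = n then ((β n * δ n : ℝ) : ℂ) * x n else 0 := by
    intro m
    have : (lp.single 1 m (x m) : ell1) = x m • lp.single 1 m (1 : ℂ) := by
      rw [← lp.single_smul]; simp
    rw [this, map_smul]
    change x m • (diagInftyOne δ (diagOneInfty β (lp.single 1 m 1)) n) = _
    rw [diagInftyOne_apply hδ, diagOneInfty_single hβ h0]
    split_ifs with h1 h2 h2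
    · subst h1; push_cast; ring
    · exact absurd h1.symm h2
    · exact absurd h2.symm h1
    · simp
  simp only [key]
  exact hasSum_ite_eq n _

lemma isEigenvalueSeq_of_diagonal {S : ell1 →L[ℂ] ell1} {lam : ℕ → ℂ}
    (hS : ∀ x n, S x n = lam n * x n) (hlam : Function.Injective lam) :
    IsEigenvalueSeq S lam := by
  have hsingle : ∀ n, S (lp.single 1 n 1) = lam n • lp.single 1 n 1 := by
    intro n
    ext k
    rw [hS]
    by_cases hk : k = n
    · subst hk; simp
    · simp [hk]
  have hne : ∀ n, (lp.single 1 n 1 : ell1) ≠ 0 := by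
    intro n h
    have := congrArg (fun x : ell1 => x n) h
    simp at this
  refine ⟨fun n _ => ⟨lp.single 1 n 1, hne n, hsingle n⟩, fun μ _ => ?_⟩
  have hpow : ∀ (k : ℕ) (x : ell1) (n : ℕ),
      ((S - μ • (1 : ell1 →L[ℂ] ell1)) ^ k) x n = (lam n - μ) ^ k * x n := by
    intro k
    induction k with
    | zero => intro x n; simp
    | succ k ih =>
      intro x n
      rw [pow_succ, mul_apply_eq_comp, ih, pow_succ, mul_assoc]
      congr 1
      change S x n - μ * x n = _
      rw [hS, sub_mul]
  have hker : ∀ (k : ℕ) (x : ell1),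
      x ∈ LinearMap.ker (((S - μ • (1 : ell1 →L[ℂ] ell1)) ^ k : ell1 →L[ℂ] ell1) :
        ell1 →ₗ[ℂ] ell1) → ∀ n, lam n ≠ μ → x n = 0 := by
    intro k x hx n hn
    have h := hpow k x n
    have h' : ((S - μ • (1 : ell1 →L[ℂ] ell1)) ^ k) x = 0 := hx
    rw [h'] at h
    exact (mul_eq_zero.1 h.symm).resolve_left (pow_ne_zero _ (sub_ne_zero.2 hn))
  unfold algebraicMultiplicity
  by_cases hμ : ∃ m, lam m = μ
  · obtain ⟨m, rfl⟩ := hμ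
    have h1 : Nat.card {n : ℕ // lam n = lam m} = 1 := by
      rw [Nat.card_eq_one_iff_unique]
      exact ⟨⟨fun a b => Subtype.ext (hlam (a.2.trans b.2.symm))⟩, ⟨⟨m, rfl⟩⟩⟩
    have h2 : (⨆ k : ℕ, LinearMap.ker (((S - lam m • (1 : ell1 →L[ℂ] ell1)) ^ k :
        ell1 →L[ℂ] ell1) : ell1 →ₗ[ℂ] ell1)) = Submodule.span ℂ {(lp.single 1 m 1 : ell1)} := by
      refine le_antisymm (iSup_le fun k x hx => ?_) ?_
      · refine Submodule.mem_span_singleton.2 ⟨x m, ?_⟩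
        ext n
        by_cases hn : n = m
        · subst hn; simp
        · rw [hker k x hx n fun h => hn (hlam h)]
          simp [hn]
      · refine le_trans ?_ (le_iSup _ 1)
        rw [Submodule.span_singleton_le_iff_mem, LinearMap.mem_ker]
        simp [hsingle]
    rw [h1, h2, finrank_span_singleton (hne m)]
  · push Not at hμ
    have h1 : Nat.card {n : ℕ // lam n = μ} = 0 := by
      have : IsEmpty {n : ℕ // lam n = μ} := ⟨fun n => hμ n.1 n.2⟩
      exact Nat.card_of_isEmpty
    have h2 : (⨆ k : ℕ, LinearMap.ker (((S - μ • (1 : ell1 →L[ℂ] ell1)) ^ k :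
        ell1 →L[ℂ] ell1) : ell1 →ₗ[ℂ] ell1)) = ⊥ := by
      refine eq_bot_iff.2 (iSup_le fun k x hx => ?_)
      rw [Submodule.mem_bot]
      ext n
      simp [hker k x hx n (hμ n)]
    rw [h1, h2, finrank_bot]

lemma norm_le_seqApproxNum_of_antitone {x : ℕ → ℂ} (hx : Antitone fun n => ‖x n‖) (n : ℕ) :
    ‖x n‖ ≤ seqApproxNum x (n + 1) := by
  refine le_csInf ⟨‖x 0‖ + 1, by positivity, ?_⟩ ?_
  · have : {i : ℕ | ‖x 0‖ + 1 ≤ ‖x i‖} = ∅ := by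
      ext i
      have : ‖x i‖ ≤ ‖x 0‖ := hx i.zero_le
      simp only [Set.mem_ofPred_eq, Set.mem_empty_iff_false, iff_false, not_le]
      linarith
    rw [this]
    simp
  · rintro c ⟨-, hfin, hcard⟩
    by_contra! hc
    have hsub : (Finset.range (n + 1) : Set ℕ) ⊆ {i : ℕ | c ≤ ‖x i‖} := fun i hi =>
      hc.le.trans (hx (Nat.lt_succ_iff.1 (Finset.mem_range.1 hi)))
    have h := Set.ncard_le_ncard hsub hfin
    rw [Set.ncard_coe_finset, Finset.card_range] at h
    exact absurd hcard (not_lt.2 h)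

/-- The number of binary digits of `n`, for `n ≠ 0`. -/
def logSucc (n : ℕ) : ℕ := Nat.log 2 n + 1

lemma logSucc_mono : Monotone logSucc := fun _ _ h => Nat.succ_le_succ (Nat.log_mono_right h)

lemma logSucc_two_pow (k : ℕ) : logSucc (2 ^ k) = k + 1 := by
  simp [logSucc]

lemma logSucc_pos (n : ℕ) : 0 < logSucc n := Nat.succ_pos _

lemma tendsto_logSucc : Filter.Tendsto logSucc Filter.atTop Filter.atTop :=
  Filter.tendsto_atTop_atTop_of_monotone logSucc_mono fun b =>
    ⟨2 ^ b, by rw [logSucc_two_pow]; omega⟩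

/-- The sequence `1 / (n (log n)^p)`, up to constants. -/
def invMulLog (p n : ℕ) : ℝ := ((n : ℝ) * (logSucc n : ℝ) ^ p)⁻¹

lemma invMulLog_nonneg (p n : ℕ) : 0 ≤ invMulLog p n := by
  unfold invMulLog; positivity

lemma invMulLog_pos (p : ℕ) {n : ℕ} (hn : 0 < n) : 0 < invMulLog p n := by
  have := logSucc_pos n
  unfold invMulLog; positivity

lemma invMulLog_le (p : ℕ) ⦃m n : ℕ⦄ (hm : 0 < m) (hmn : m ≤ n) :
    invMulLog p n ≤ invMulLog p m := by
  have h1 := logSucc_pos m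
  have h2 := logSucc_mono hmn
  unfold invMulLog
  gcongr

lemma summable_invMulLog_two : Summable (invMulLog 2) := by
  rw [← summable_condensed_iff_of_nonneg (invMulLog_nonneg 2) (invMulLog_le 2)]
  have h := (summable_nat_add_iff 1).2 (Real.summable_nat_pow_inv.2 one_lt_two)
  refine h.congr fun k => ?_
  rw [invMulLog, logSucc_two_pow]
  push_cast
  field_simp

lemma not_summable_invMulLog_rpow (p : ℕ) {s : ℝ} (hs : 0 < s) (hs1 : s < 1) :
    ¬ Summable fun n => invMulLog p n ^ s := by
  rw [← summable_condensed_iff_of_nonneg (fun n => Real.rpow_nonneg (invMulLog_nonneg p n) s)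
    fun m n hm hmn => Real.rpow_le_rpow (invMulLog_nonneg p n) (invMulLog_le p hm hmn) hs.le]
  intro hsum
  set r : ℝ := 2 ^ (1 - s) with hr
  have hr1 : 1 < r := Real.one_lt_rpow one_lt_two (by linarith)
  have hpoly := (tendsto_pow_const_div_const_pow_of_one_lt p hr1).comp
    (Filter.tendsto_add_atTop_nat 1)
  have hprod := hsum.tendsto_atTop_zero.mul hpoly
  rw [mul_zero] at hprod
  have hbound : ∀ k : ℕ, r⁻¹ ≤ (2 : ℝ) ^ k * invMulLog p (2 ^ k) ^ s *
      (((k + 1 : ℕ) : ℝ) ^ p / r ^ (k + 1)) := by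
    intro k
    have hk : (1 : ℝ) ≤ ((k + 1 : ℕ) : ℝ) ^ p := one_le_pow₀ (by exact_mod_cast k.succ_pos)
    set c : ℝ := ((k + 1 : ℕ) : ℝ) ^ p
    have hc : 0 < c := by linarith
    have hcs : c ^ s ≤ c := by
      simpa using Real.rpow_le_rpow_of_exponent_le hk hs1.le
    have hrk : (2 : ℝ) ^ k = r ^ k * ((2 : ℝ) ^ k) ^ s := by
      rw [hr, ← Real.rpow_natCast, ← Real.rpow_natCast, ← Real.rpow_mul two_pos.le,
        ← Real.rpow_mul two_pos.le, ← Real.rpow_add two_pos]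
      ring_nf
    have h2 : (0 : ℝ) < ((2 : ℝ) ^ k) ^ s := by positivity
    have hr0 : 0 < r := by linarith
    have hcs0 : 0 < c ^ s := by positivity
    have : (2 : ℝ) ^ k * invMulLog p (2 ^ k) ^ s * (c / r ^ (k + 1)) = r⁻¹ * (c / c ^ s) := by
      have : invMulLog p (2 ^ k) ^ s = (((2 : ℝ) ^ k) ^ s)⁻¹ * (c ^ s)⁻¹ := by
        rw [invMulLog, logSucc_two_pow, Real.inv_rpow (by positivity),
          Real.mul_rpow (by positivity) (by positivity), mul_inv]
        simp [c]
      rw [this]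
      nth_rw 1 [hrk]
      rw [pow_succ]
      field_simp
    rw [this]
    exact le_mul_of_one_le_right (by positivity) ((one_le_div hcs0).2 hcs)
  have := ge_of_tendsto' hprod hbound
  have hr0 : 0 < r⁻¹ := by positivity
  linarith

/-- The sequence `1 / (n log n (log log n)^p)`, up to constants. -/
def invMulLogLog (p n : ℕ) : ℝ := (n : ℝ)⁻¹ * invMulLog p (logSucc n)

lemma invMulLogLog_nonneg (p n : ℕ) : 0 ≤ invMulLogLog p n :=
  mul_nonneg (by positivity) (invMulLog_nonneg _ _)

lemma invMulLogLog_lt (p : ℕ) ⦃m n : ℕ⦄ (hm : 0 < m) (hmn : m < n) :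
    invMulLogLog p n < invMulLogLog p m :=
  mul_lt_mul (by gcongr) (invMulLog_le p (logSucc_pos m) (logSucc_mono hmn.le))
    (invMulLog_pos p (logSucc_pos n)) (by positivity)

lemma invMulLogLog_le (p : ℕ) ⦃m n : ℕ⦄ (hm : 0 < m) (hmn : m ≤ n) :
    invMulLogLog p n ≤ invMulLogLog p m :=
  hmn.eq_or_lt.elim (fun h => h ▸ le_rfl) fun h => (invMulLogLog_lt p hm h).le

lemma summable_invMulLogLog_two : Summable (invMulLogLog 2) := by
  rw [← summable_condensed_iff_of_nonneg (invMulLogLog_nonneg 2) (invMulLogLog_le 2)]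
  refine ((summable_nat_add_iff 1).2 summable_invMulLog_two).congr fun k => ?_
  rw [invMulLogLog, logSucc_two_pow]
  push_cast
  field_simp

lemma not_summable_rpow_mul_invMulLogLog (p : ℕ) {s : ℝ} (hs : 0 < s) (hs1 : s < 1) :
    ¬ Summable fun n : ℕ => ((n : ℝ) + 1) ^ (s - 1) * invMulLogLog p (n + 1) ^ s := by
  have hcond := summable_condensed_iff_of_nonneg
    (f := fun n : ℕ => (n : ℝ)⁻¹ * invMulLog p (logSucc n) ^ s)
    (fun n => mul_nonneg (by positivity) (Real.rpow_nonneg (invMulLog_nonneg _ _) s))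
    fun m n hm hmn => mul_le_mul (by gcongr)
      (Real.rpow_le_rpow (invMulLog_nonneg _ _)
        (invMulLog_le p (logSucc_pos m) (logSucc_mono hmn)) hs.le)
      (Real.rpow_nonneg (invMulLog_nonneg _ _) s) (by positivity)
  intro hsum
  refine not_summable_invMulLog_rpow p hs hs1 ((summable_nat_add_iff 1).1 ?_)
  have : Summable fun n : ℕ => (n : ℝ)⁻¹ * invMulLog p (logSucc n) ^ s := by
    rw [← summable_nat_add_iff 1]
    refine hsum.congr fun n => ?_
    have hn : (0 : ℝ) < (n : ℝ) + 1 := by positivity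
    rw [invMulLogLog, Real.mul_rpow (by positivity) (invMulLog_nonneg _ _), ← mul_assoc]
    push_cast
    rw [Real.inv_rpow hn.le, Real.rpow_sub_one hn.ne']
    have : ((n : ℝ) + 1) ^ s ≠ 0 := (Real.rpow_pos_of_pos hn s).ne'
    field_simp
  refine (hcond.2 this).congr fun k => ?_
  rw [logSucc_two_pow]
  push_cast
  field_simp

/-- There exist Banach spaces `Z`, `W` and nuclear operators
`t₁ : Z → W`, `t₂ : W → Z` such that the eigenvalue sequence of `t₂ ∘ t₁ : Z → Z`
belongs to `ℓ_1` but does not belong to the Lorentz space `ℓ_{1,s}` for any `s < 1`. -/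
theorem exists_nuclear_nuclear_eigenvalues_l1_not_lorentz :
    ∃ (Z : Type) (_ : NormedAddCommGroup Z) (_ : NormedSpace ℂ Z) (_ : CompleteSpace Z)
      (W : Type) (_ : NormedAddCommGroup W) (_ : NormedSpace ℂ W) (_ : CompleteSpace W)
      (t₁ : Z →L[ℂ] W) (t₂ : W →L[ℂ] Z),
      RNuclear 1 t₁ ∧ RNuclear 1 t₂ ∧
      ∃ lam : ℕ → ℂ, IsEigenvalueSeq (t₂.comp t₁) lam ∧
        (Summable fun n => ‖lam n‖) ∧
        ∀ s : ℝ, 0 < s → s < 1 → ¬ MemLorentzSeq 1 s lam := by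
  have hβ : Antitone fun n : ℕ => ((logSucc (logSucc (n + 1)) : ℕ) : ℝ)⁻¹ := by
    intro m n hmn
    have h1 := logSucc_pos (logSucc (m + 1))
    have h2 := logSucc_mono (logSucc_mono (Nat.succ_le_succ hmn))
    dsimp only
    gcongr
  have hβ0 : Filter.Tendsto (fun n : ℕ => ((logSucc (logSucc (n + 1)) : ℕ) : ℝ)⁻¹)
      Filter.atTop (nhds 0) :=
    tendsto_inv_atTop_zero.comp (tendsto_natCast_atTop_atTop.comp
      (tendsto_logSucc.comp (tendsto_logSucc.comp (Filter.tendsto_add_atTop_nat 1))))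
  have hδ : Summable fun n : ℕ => invMulLogLog 2 (n + 1) :=
    (summable_nat_add_iff 1).2 summable_invMulLogLog_two
  have hmul : ∀ n : ℕ, ((logSucc (logSucc (n + 1)) : ℕ) : ℝ)⁻¹ * invMulLogLog 2 (n + 1) =
      invMulLogLog 3 (n + 1) := by
    intro n
    simp only [invMulLogLog, invMulLog, mul_inv, pow_succ]
    ring
  have hanti : StrictAnti fun n : ℕ => invMulLogLog 3 (n + 1) := fun m n hmn =>
    invMulLogLog_lt 3 m.succ_pos (Nat.succ_lt_succ hmn)
  have hnorm : ∀ n : ℕ, ‖((invMulLogLog 3 (n + 1) : ℝ) : ℂ)‖ = invMulLogLog 3 (n + 1) := by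
    intro n
    rw [Complex.norm_real, Real.norm_of_nonneg (invMulLogLog_nonneg _ _)]
  refine ⟨ell1, inferInstance, inferInstance, inferInstance, ellInfty, inferInstance,
    inferInstance, inferInstance, _, _, rNuclear_diagOneInfty hβ hβ0, rNuclear_diagInftyOne hδ,
    fun n => ((invMulLogLog 3 (n + 1) : ℝ) : ℂ), ?_, ?_, ?_⟩
  · refine isEigenvalueSeq_of_diagonal (fun x n => ?_)
      (Complex.ofReal_injective.comp hanti.injective)
    rw [diagInftyOne_comp_diagOneInfty_apply hβ hβ0 hδ, hmul]
  · refine Summable.of_nonneg_of_le (fun n => norm_nonneg _)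
      (fun n => (hnorm n).trans_le <| (hmul n).symm.trans_le <|
        mul_le_of_le_one_left (invMulLogLog_nonneg _ _) ?_) hδ
    exact inv_le_one_of_one_le₀ (by exact_mod_cast logSucc_pos _)
  · rintro s hs hs1 ⟨-, hsum⟩
    rw [div_one] at hsum
    refine not_summable_rpow_mul_invMulLogLog 3 hs hs1
      (Summable.of_nonneg_of_le (fun n => ?_) (fun n => ?_) hsum)
    · exact mul_nonneg (by positivity) (Real.rpow_nonneg (invMulLogLog_nonneg _ _) s)
    · have h := norm_le_seqApproxNum_of_antitone
        (x := fun n => ((invMulLogLog 3 (n + 1) : ℝ) : ℂ))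
        (by simpa only [hnorm] using hanti.antitone) n
      rw [hnorm] at h
      have := invMulLogLog_nonneg 3 (n + 1)
      gcongr

end
end

section
/- For every r ∈ (0,1) there exist Banach spaces Z and W, an r-nuclear operator t₁ : Z → W and a nuclear operator t₂ : W → Z such that the eigenvalue sequence of t₂∘t₁ : Z → Z belongs to ℓ_r but does not belong to the Lorentz space ℓ_{r,s} for any s < r. -/
open scoped ENNReal NNReal ComplexConjugate
open MeasureTheory

open scoped BoundedContinuousFunction

noncomputable section

/-- A family which is `r`-summable for some `0 < r ≤ 1` is absolutely summable. -/
theorem summable_norm_of_summable_rpow {I : Type*} {r : ℝ} (hr0 : 0 < r) (hr1 : r ≤ 1)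
    {a : I → ℂ} (ha : Summable fun i => ‖a i‖ ^ r) : Summable fun i => ‖a i‖ := by
  refine Summable.of_norm_bounded_eventually ha ?_
  have h := ha.tendsto_cofinite_zero.eventually (gt_mem_nhds zero_lt_one)
  filter_upwards [h] with i hi
  have hle : ‖a i‖ ≤ 1 := by
    by_contra! hcon
    exact absurd hi (not_lt.2 (Real.one_le_rpow hcon.le hr0.le))
  rw [norm_norm]
  rcases (norm_nonneg (a i)).eq_or_lt with h0 | h0
  · rw [← h0, Real.zero_rpow hr0.ne']
  · simpa using Real.rpow_le_rpow_of_exponent_ge h0 hle hr1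

/-- A bounded kernel with `r`-summable column weights defines an `r`-nuclear operator on
the space of bounded functions. -/
theorem exists_rNuclear_of_kernel {I : Type*} [TopologicalSpace I] [DiscreteTopology I]
    {r : ℝ} (hr0 : 0 < r) (hr1 : r ≤ 1) (e : ℕ ≃ I) {a : I → ℂ}
    (ha : Summable fun i => ‖a i‖ ^ r) {K : I → I → ℂ} (hK : ∀ p q, ‖K p q‖ ≤ 1) :
    ∃ T : (I →ᵇ ℂ) →L[ℂ] (I →ᵇ ℂ), RNuclear r T ∧
      ∀ x p, HasSum (fun q => a q * x q * K p q) (T x p) := by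
  let ev : I → (I →ᵇ ℂ) →L[ℂ] ℂ := fun i => BoundedContinuousFunction.evalCLM ℂ i
  have hev : ∀ i, ‖ev i‖ ≤ 1 := fun i =>
    ContinuousLinearMap.opNorm_le_bound _ zero_le_one fun x => by
      simpa [ev] using x.norm_coe_le_norm i
  let y : I → I →ᵇ ℂ := fun q =>
    BoundedContinuousFunction.ofNormedAddCommGroupDiscrete (fun p => K p q) 1 (fun p => hK p q)
  have hy : ∀ q, ‖y q‖ ≤ 1 := fun q =>
    (BoundedContinuousFunction.norm_le zero_le_one).2 fun p => hK p q
  have hsum : Summable fun q => a q • (ev q).smulRight (y q) := by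
    refine Summable.of_norm_bounded (summable_norm_of_summable_rpow hr0 hr1 ha) fun q => ?_
    rw [norm_smul, ContinuousLinearMap.norm_smulRight_apply]
    exact mul_le_of_le_one_right (norm_nonneg _)
      (mul_le_one₀ (hev q) (norm_nonneg _) (hy q))
  have happ : ∀ x, HasSum (fun q => (a q * ev q x) • y q)
      ((∑' q, a q • (ev q).smulRight (y q)) x) := fun x => by
    simpa [mul_smul] using
      (ContinuousLinearMap.apply ℂ (I →ᵇ ℂ) x).hasSum hsum.hasSum
  refine ⟨∑' q, a q • (ev q).smulRight (y q),
    ⟨a ∘ e, ev ∘ e, y ∘ e, fun n => hev _, fun n => hy _, ?_, fun x => ?_⟩, fun x p => ?_⟩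
  · exact e.summable_iff.2 ha
  · exact (((e.hasSum_iff).2 (happ x)).tsum_eq).symm
  · simpa [ev, y] using (ev p).hasSum (happ x)

/-- The algebraic multiplicity of a value of a diagonal operator on bounded functions. -/
theorem algebraicMultiplicity_diagonal {I : Type*} [TopologicalSpace I] [DiscreteTopology I]
    {S : (I →ᵇ ℂ) →L[ℂ] (I →ᵇ ℂ)} {d : I → ℂ} (hS : ∀ x i, S x i = d i * x i) {μ : ℂ}
    (hfin : {i | d i = μ}.Finite) :
    algebraicMultiplicity S μ = Nat.card {i // d i = μ} := by
  classical
  have hpow : ∀ (k : ℕ) (x : I →ᵇ ℂ) (i : I),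
      ((S - μ • (1 : (I →ᵇ ℂ) →L[ℂ] (I →ᵇ ℂ))) ^ k) x i = (d i - μ) ^ k * x i := by
    intro k
    induction k with
    | zero => simp
    | succ k ih =>
      intro x i
      rw [pow_succ, mul_apply_eq_comp, ih]
      simp [hS]
      ring
  let V : Submodule ℂ (I →ᵇ ℂ) :=
    { carrier := {x | ∀ i, d i ≠ μ → x i = 0}
      add_mem' := fun {x y} hx hy i hi => by simp [hx i hi, hy i hi]
      zero_mem' := fun i _ => rfl
      smul_mem' := fun c x hx i hi => by simp [hx i hi] }
  have hV : (⨆ k : ℕ, LinearMap.ker ((((S - μ • (1 : (I →ᵇ ℂ) →L[ℂ] (I →ᵇ ℂ))) ^ k :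
      (I →ᵇ ℂ) →L[ℂ] (I →ᵇ ℂ))) : (I →ᵇ ℂ) →ₗ[ℂ] (I →ᵇ ℂ))) = V := by
    refine le_antisymm (iSup_le fun k x hx i hi => ?_) (le_trans (fun x hx => ?_) (le_iSup _ 1))
    · have h := DFunLike.congr_fun (LinearMap.mem_ker.1 hx) i
      rw [ContinuousLinearMap.coe_coe, hpow] at h
      exact (mul_eq_zero.1 h).resolve_left (pow_ne_zero _ (sub_ne_zero.2 hi))
    · rw [LinearMap.mem_ker, ContinuousLinearMap.coe_coe]
      ext i
      rw [hpow]
      by_cases hi : d i = μ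
      · simp [hi]
      · simp [hx i hi]
  have : Fintype {i // d i = μ} := hfin.fintype
  let E : V ≃ₗ[ℂ] ({i // d i = μ} → ℂ) :=
    { toFun := fun x i => x.1 i.1
      map_add' := fun x y => rfl
      map_smul' := fun c x => rfl
      invFun := fun f => ⟨BoundedContinuousFunction.ofNormedAddCommGroupDiscrete
        (fun i => if h : d i = μ then f ⟨i, h⟩ else 0) ‖f‖ (fun i => by
          split_ifs with h
          · exact norm_le_pi_norm f _
          · simp), fun i hi => by simp [hi]⟩
      left_inv := fun x => by
        ext i
        by_cases hi : d i = μ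
        · simp [hi]
        · simp [hi, x.2 i hi]
      right_inv := fun f => by
        ext i
        simp [i.2] }
  rw [algebraicMultiplicity, hV, E.finrank_eq, Module.finrank_fintype_fun_eq_card,
    Nat.card_eq_fintype_card]

/-- The diagonal of a diagonal operator with vanishing diagonal is its eigenvalue sequence. -/
theorem isEigenvalueSeq_diagonal {I : Type*} [TopologicalSpace I] [DiscreteTopology I]
    {S : (I →ᵇ ℂ) →L[ℂ] (I →ᵇ ℂ)} {d : I → ℂ} (hS : ∀ x i, S x i = d i * x i)
    (hfin : ∀ μ, μ ≠ 0 → {i | d i = μ}.Finite) (e : ℕ ≃ I) :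
    IsEigenvalueSeq S (d ∘ e) := by
  classical
  refine ⟨fun n _ => ?_, fun μ hμ => ?_⟩
  · refine ⟨BoundedContinuousFunction.ofNormedAddCommGroupDiscrete
      (fun i => if i = e n then 1 else 0) 1 (fun i => by split_ifs <;> simp), fun h => ?_, ?_⟩
    · simpa using DFunLike.congr_fun h (e n)
    · ext i
      rw [hS]
      by_cases hi : i = e n <;> simp [hi]
  · rw [algebraicMultiplicity_diagonal hS (hfin μ hμ)]
    exact Nat.card_congr (e.subtypeEquiv fun n => Iff.rfl)

/-- If `n` distinct entries of a bounded family have modulus at least `c`, then its `n`-th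
approximation number is at least `c`. -/
theorem le_seqApproxNum {I : Type*} {x : I → ℂ} (hx : BddAbove (Set.range fun i => ‖x i‖))
    {n : ℕ} (hn : 0 < n) {c : ℝ} {f : Fin n → I} (hf : Function.Injective f)
    (hc : ∀ m, c ≤ ‖x (f m)‖) : c ≤ seqApproxNum x n := by
  refine le_csInf ?_ ?_
  · obtain ⟨B, hB⟩ := hx
    have hempty : {i : I | |B| + 1 ≤ ‖x i‖} = ∅ := by
      refine Set.eq_empty_of_forall_notMem fun i hi => ?_
      have h1 : ‖x i‖ ≤ B := hB ⟨i, rfl⟩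
      have h2 : |B| + 1 ≤ ‖x i‖ := hi
      linarith [le_abs_self B]
    refine ⟨|B| + 1, by positivity, ?_, ?_⟩
    · rw [hempty]; exact Set.finite_empty
    · rw [hempty]; simpa using hn
  · rintro b ⟨-, hfin, hcard⟩
    by_contra! hbc
    have : Finite {i : I | b ≤ ‖x i‖} := hfin
    let g : Fin n → {i : I | b ≤ ‖x i‖} := fun m => ⟨f m, hbc.le.trans (hc m)⟩
    have hg : Function.Injective g := fun m m' h => hf (congrArg Subtype.val h)
    have h := Nat.card_le_card_of_injective g hg
    rw [Nat.card_fin] at h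
    exact absurd hcard (not_lt.2 h)

/-- The disjoint union of the cyclic groups of order `N k + 1`. -/
abbrev CyclicBlocks (N : ℕ → ℕ) : Type := Σ k, ZMod (N k + 1)

namespace CyclicBlocks

variable {N : ℕ → ℕ}

instance : TopologicalSpace (CyclicBlocks N) := ⊥

instance : DiscreteTopology (CyclicBlocks N) := ⟨rfl⟩

/-- A block-diagonal kernel. -/
def blockKernel (F : ∀ k, ZMod (N k + 1) → ZMod (N k + 1) → ℂ) (p q : CyclicBlocks N) : ℂ :=
  if h : q.1 = p.1 then F p.1 p.2 (h ▸ q.2) else 0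

theorem norm_blockKernel_le {F : ∀ k, ZMod (N k + 1) → ZMod (N k + 1) → ℂ}
    (hF : ∀ k i j, ‖F k i j‖ ≤ 1) (p q : CyclicBlocks N) : ‖blockKernel F p q‖ ≤ 1 := by
  unfold blockKernel
  split_ifs
  · exact hF _ _ _
  · simp

theorem hasSum_blockKernel (F : ∀ k, ZMod (N k + 1) → ZMod (N k + 1) → ℂ)
    (a : CyclicBlocks N → ℂ) (k : ℕ) (i : ZMod (N k + 1)) :
    HasSum (fun q => a q * blockKernel F ⟨k, i⟩ q) (∑ j, a ⟨k, j⟩ * F k i j) := by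
  have h := hasSum_sum_of_ne_finset_zero
    (L := .unconditional _) (f := fun q : CyclicBlocks N => a q * blockKernel F ⟨k, i⟩ q)
    (s := Finset.univ.map (Function.Embedding.sigmaMk k)) (fun q hq => by
      obtain ⟨l, j⟩ := q
      by_cases hl : l = k
      · subst hl
        exact absurd (Finset.mem_map.2 ⟨j, Finset.mem_univ _, rfl⟩) hq
      · simp [blockKernel, hl])
  rw [Finset.sum_map] at h
  simpa [blockKernel, Function.Embedding.sigmaMk] using h

/-- A nonnegative family on the blocks is summable if its block sums are. -/
theorem summable_of_sum_eq {f : CyclicBlocks N → ℝ} (hf : ∀ p, 0 ≤ f p) {g : ℕ → ℝ}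
    (hg : Summable g) (h : ∀ k, ∑ i, f ⟨k, i⟩ = g k) : Summable f := by
  refine (summable_sigma_of_nonneg hf).2 ⟨fun k => (hasSum_fintype _).summable, ?_⟩
  simpa [tsum_fintype, h] using hg

theorem sum_val {n : ℕ} (f : ℕ → ℝ) :
    ∑ i : ZMod (n + 1), f i.val = ∑ i ∈ Finset.range (n + 1), f i :=
  Fin.sum_univ_eq_sum_range f (n + 1)

/-- Orthogonality of the characters of a cyclic group. -/
theorem sum_stdAddChar_mul {n : ℕ} (g : ZMod (n + 1) → ℂ) (i : ZMod (n + 1)) :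
    ∑ j, (∑ l, g l * ZMod.stdAddChar (j * l)) * ZMod.stdAddChar (-(i * j)) =
      ((n : ℂ) + 1) * g i := by
  simp_rw [Finset.sum_mul]
  rw [Finset.sum_comm]
  have key : ∀ l, ∑ j : ZMod (n + 1),
      g l * ZMod.stdAddChar (j * l) * ZMod.stdAddChar (-(i * j)) =
        if l = i then ((n : ℂ) + 1) * g i else 0 := by
    intro l
    have h := AddChar.sum_mulShift (R' := ℂ) (l - i) (ZMod.isPrimitive_stdAddChar (n + 1))
    have h2 : ∀ j : ZMod (n + 1),
        g l * ZMod.stdAddChar (j * l) * ZMod.stdAddChar (-(i * j)) =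
          g l * ZMod.stdAddChar (j * (l - i)) := by
      intro j
      rw [mul_assoc, ← AddChar.map_add_eq_mul]
      congr 2
      ring
    simp_rw [h2]
    rw [← Finset.mul_sum, h]
    by_cases hl : l = i
    · simp [hl, mul_comm]
    · simp [hl, sub_eq_zero]
  simp_rw [key]
  simp

/-- A diagonal operator whose diagonal is an `r`-summable family, damped on the `k`-th block
by the factor `2⁻ᵏ`, is the product of an `r`-nuclear and a nuclear operator. -/
theorem exists_rNuclear_nuclear_diagonal {r : ℝ} (hr0 : 0 < r) (hr1 : r ≤ 1)
    (e : ℕ ≃ CyclicBlocks N) {a : CyclicBlocks N → ℂ} (ha : Summable fun p => ‖a p‖ ^ r) :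
    ∃ t₁ t₂ : (CyclicBlocks N →ᵇ ℂ) →L[ℂ] (CyclicBlocks N →ᵇ ℂ),
      RNuclear r t₁ ∧ RNuclear 1 t₂ ∧
      ∀ x p, t₂.comp t₁ x p = ((1 / 2 : ℂ) ^ p.1 * a p) * x p := by
  have hchar : ∀ (n : ℕ) (z : ZMod (n + 1)), ‖(ZMod.stdAddChar z : ℂ)‖ ≤ 1 := fun n z =>
    (AddChar.norm_apply _ _).le
  let b : CyclicBlocks N → ℂ := fun p => (1 / 2 : ℂ) ^ p.1 / ((N p.1 : ℂ) + 1)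
  have hnorm : ∀ p, ‖b p‖ = (1 / 2 : ℝ) ^ p.1 / ((N p.1 : ℝ) + 1) := fun p => by
    have : ‖(N p.1 : ℂ) + 1‖ = (N p.1 : ℝ) + 1 := by
      exact_mod_cast Complex.norm_natCast (N p.1 + 1)
    simp [b, this]
  have hb : Summable fun p => ‖b p‖ ^ (1 : ℝ) := by
    simp_rw [Real.rpow_one]
    refine summable_of_sum_eq (fun _ => norm_nonneg _) summable_geometric_two fun k => ?_
    simp_rw [hnorm]
    rw [Finset.sum_const, Finset.card_univ, ZMod.card, nsmul_eq_mul]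
    push_cast
    field_simp
  obtain ⟨t₁, h₁, ht₁⟩ := exists_rNuclear_of_kernel hr0 hr1 e ha
    (norm_blockKernel_le (F := fun k i j => ZMod.stdAddChar (i * j)) fun k i j => hchar _ _)
  obtain ⟨t₂, h₂, ht₂⟩ := exists_rNuclear_of_kernel one_pos le_rfl e hb
    (norm_blockKernel_le (F := fun k i j => ZMod.stdAddChar (-(i * j))) fun k i j => hchar _ _)
  refine ⟨t₁, t₂, h₁, h₂, ?_⟩
  rintro x ⟨k, i⟩
  have e₁ : ∀ j, t₁ x ⟨k, j⟩ = ∑ l, a ⟨k, l⟩ * x ⟨k, l⟩ * ZMod.stdAddChar (j * l) := fun j =>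
    (ht₁ x ⟨k, j⟩).unique (hasSum_blockKernel _ (fun q => a q * x q) k j)
  have e₂ := (ht₂ (t₁ x) ⟨k, i⟩).unique (hasSum_blockKernel _ (fun q => b q * t₁ x q) k i)
  have hN : (N k : ℂ) + 1 ≠ 0 := Nat.cast_add_one_ne_zero _
  rw [ContinuousLinearMap.comp_apply, e₂]
  simp_rw [e₁, b, mul_assoc ((1 / 2 : ℂ) ^ k / _)]
  rw [← Finset.mul_sum, sum_stdAddChar_mul (fun l => a ⟨k, l⟩ * x ⟨k, l⟩) i]
  field_simp

/-- The partial sum of the harmonic series along the `k`-th block. -/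
def blockHarmonic (N : ℕ → ℕ) (k : ℕ) : ℝ := ∑ i ∈ Finset.range (N k + 1), 1 / ((i : ℝ) + 1)

theorem blockHarmonic_pos (k : ℕ) : 0 < blockHarmonic N k :=
  Finset.sum_pos (fun _ _ => by positivity) ⟨0, by simp⟩

/-- The family whose `r`-th powers are harmonic on each block, with total mass `2⁻ᵏ` on the
`k`-th block. -/
def harmonicWeight (N : ℕ → ℕ) (r : ℝ) (k i : ℕ) : ℝ :=
  ((1 / 2 : ℝ) ^ k / blockHarmonic N k * (1 / ((i : ℝ) + 1))) ^ (1 / r)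

theorem harmonicWeight_nonneg (r : ℝ) (k i : ℕ) : 0 ≤ harmonicWeight N r k i := by
  have := blockHarmonic_pos (N := N) k
  unfold harmonicWeight
  positivity

theorem harmonicWeight_rpow (r s : ℝ) (k i : ℕ) :
    harmonicWeight N r k i ^ s =
      ((1 / 2 : ℝ) ^ k / blockHarmonic N k * (1 / ((i : ℝ) + 1))) ^ (s / r) := by
  have := blockHarmonic_pos (N := N) k
  rw [harmonicWeight, ← Real.rpow_mul (by positivity)]
  congr 1
  ring

theorem harmonicWeight_anti {r : ℝ} (hr : 0 < r) (k : ℕ) : Antitone (harmonicWeight N r k) := by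
  intro i j hij
  have := blockHarmonic_pos (N := N) k
  unfold harmonicWeight
  gcongr

theorem summable_harmonicWeight {r : ℝ} (hr : 0 < r) :
    Summable fun p : CyclicBlocks N => harmonicWeight N r p.1 p.2.val ^ r := by
  refine summable_of_sum_eq (fun _ => Real.rpow_nonneg (harmonicWeight_nonneg _ _ _) _)
    summable_geometric_two fun k => ?_
  simp_rw [harmonicWeight_rpow, div_self hr.ne', Real.rpow_one]
  rw [sum_val (fun i => (1 / 2 : ℝ) ^ k / blockHarmonic N k * (1 / ((i : ℝ) + 1))),
    ← Finset.mul_sum]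
  exact div_mul_cancel₀ _ (blockHarmonic_pos k).ne'

theorem sum_lorentz_harmonicWeight (r s : ℝ) (k : ℕ) :
    ∑ n ∈ Finset.range (N k + 1), ((n : ℝ) + 1) ^ (s / r - 1) *
      ((1 / 2 : ℝ) ^ k * harmonicWeight N r k n) ^ s =
      ((2 : ℝ) ^ k) ^ (-(s + s / r)) * blockHarmonic N k ^ (1 - s / r) := by
  have hH := blockHarmonic_pos (N := N) k
  have h : ∀ n : ℕ, ((n : ℝ) + 1) ^ (s / r - 1) *
      ((1 / 2 : ℝ) ^ k * harmonicWeight N r k n) ^ s =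
      ((2 : ℝ) ^ k) ^ (-(s + s / r)) * blockHarmonic N k ^ (-(s / r)) *
        (1 / ((n : ℝ) + 1)) := by
    intro n
    have hn : (0 : ℝ) < (n : ℝ) + 1 := by positivity
    have h2 : (0 : ℝ) < 2 ^ k := by positivity
    rw [Real.mul_rpow (by positivity) (harmonicWeight_nonneg _ _ _), harmonicWeight_rpow,
      Real.mul_rpow (by positivity) (by positivity), Real.div_rpow (by positivity) hH.le,
      one_div_pow, one_div, one_div, Real.inv_rpow h2.le, Real.inv_rpow h2.le,
      Real.inv_rpow hn.le, ← Real.rpow_neg h2.le, ← Real.rpow_neg h2.le, neg_add,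
      Real.rpow_add h2, Real.rpow_sub_one hn.ne', Real.rpow_neg hH.le]
    have : ((n : ℝ) + 1) ^ (s / r) ≠ 0 := (Real.rpow_pos_of_pos hn _).ne'
    field_simp
  simp_rw [h]
  rw [← Finset.mul_sum, mul_assoc]
  change _ * (_ * blockHarmonic N k) = _
  rw [← Real.rpow_add_one hH.ne']
  congr 2
  ring

/-- If the harmonic sums of the blocks grow fast enough, the damped harmonic weights belong to
no Lorentz space `ℓ_{r,s}` with `s < r`. -/
theorem not_memLorentzSeq {r s : ℝ} (hr : 0 < r) (hs : 0 < s) (hsr : s < r)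
    (hN : ∀ k, ((2 : ℝ) ^ k) ^ k ≤ blockHarmonic N k) (e : ℕ ≃ CyclicBlocks N)
    {d : CyclicBlocks N → ℂ}
    (hd : ∀ p, ‖d p‖ = (1 / 2 : ℝ) ^ p.1 * harmonicWeight N r p.1 p.2.val) :
    ¬ MemLorentzSeq r s (d ∘ e) := by
  rintro ⟨hbdd, hsum⟩
  have hθ : 0 < 1 - s / r := by rw [sub_pos, div_lt_one hr]; exact hsr
  have hterm : ∀ k, ∀ n ∈ Finset.range (N k + 1),
      (1 / 2 : ℝ) ^ k * harmonicWeight N r k n ≤ seqApproxNum (d ∘ e) (n + 1) := by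
    intro k n hn
    rw [Finset.mem_range] at hn
    have hval : ∀ m : Fin (n + 1), ((m : ℕ) : ZMod (N k + 1)).val = m := fun m =>
      ZMod.val_natCast_of_lt (by omega)
    refine le_seqApproxNum hbdd n.succ_pos
      (f := fun m : Fin (n + 1) => e.symm ⟨k, ((m : ℕ) : ZMod (N k + 1))⟩) ?_ ?_
    · intro m m' h
      have h' := congrArg ZMod.val (sigma_mk_injective (β := fun k => ZMod (N k + 1)) (e.symm.injective h))
      rw [hval, hval] at h'
      exact Fin.ext h'
    · intro m
      rw [Function.comp_apply, Equiv.apply_symm_apply, hd, hval]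
      gcongr
      exact harmonicWeight_anti hr k (by omega)
  have hnonneg : ∀ n, 0 ≤ seqApproxNum (d ∘ e) n := fun n =>
    Real.sInf_nonneg fun c hc => hc.1
  have hlow : ∀ k : ℕ, ((2 : ℝ) ^ k) ^ (k * (1 - s / r) - (s + s / r)) ≤
      ∑' n : ℕ, ((n : ℝ) + 1) ^ (s / r - 1) * seqApproxNum (d ∘ e) (n + 1) ^ s := by
    intro k
    have h2 : (0 : ℝ) < 2 ^ k := by positivity
    calc ((2 : ℝ) ^ k) ^ (k * (1 - s / r) - (s + s / r))
        = ((2 : ℝ) ^ k) ^ (-(s + s / r)) * (((2 : ℝ) ^ k) ^ k) ^ (1 - s / r) := by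
          rw [← Real.rpow_natCast _ k, ← Real.rpow_natCast _ k, ← Real.rpow_mul (by positivity),
            ← Real.rpow_mul (by positivity), ← Real.rpow_mul (by positivity),
            ← Real.rpow_mul (by positivity), ← Real.rpow_add two_pos]
          congr 1
          ring
      _ ≤ ((2 : ℝ) ^ k) ^ (-(s + s / r)) * blockHarmonic N k ^ (1 - s / r) := by
          gcongr
          exact hN k
      _ = _ := (sum_lorentz_harmonicWeight r s k).symm
      _ ≤ ∑ n ∈ Finset.range (N k + 1),
          ((n : ℝ) + 1) ^ (s / r - 1) * seqApproxNum (d ∘ e) (n + 1) ^ s := by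
          refine Finset.sum_le_sum fun n hn => ?_
          have := harmonicWeight_nonneg (N := N) r k n
          gcongr
          exact hterm k n hn
      _ ≤ _ := hsum.sum_le_tsum _ fun n _ =>
          mul_nonneg (by positivity) (Real.rpow_nonneg (hnonneg _) _)
  have hlim : Filter.Tendsto (fun k : ℕ => (k : ℝ) * (1 - s / r) - (s + s / r))
      Filter.atTop Filter.atTop :=
    Filter.tendsto_atTop_add_const_right _ _
      (tendsto_natCast_atTop_atTop.atTop_mul_const hθ)
  have hpow : Filter.Tendsto (fun k : ℕ => (2 : ℝ) ^ k) Filter.atTop Filter.atTop :=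
    tendsto_pow_atTop_atTop_of_one_lt one_lt_two
  obtain ⟨k, hk1, hk2⟩ := ((hlim.eventually_ge_atTop 1).and (hpow.eventually_gt_atTop
    (∑' n : ℕ, ((n : ℝ) + 1) ^ (s / r - 1) * seqApproxNum (d ∘ e) (n + 1) ^ s))).exists
  have h := Real.rpow_le_rpow_of_exponent_le (one_le_pow₀ (one_le_two (α := ℝ)) (n := k)) hk1
  rw [Real.rpow_one] at h
  exact absurd (hk2.trans_le (h.trans (hlow k))) (lt_irrefl _)

theorem exists_le_blockHarmonic : ∃ N : ℕ → ℕ, ∀ k, ((2 : ℝ) ^ k) ^ k ≤ blockHarmonic N k := by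
  have h : ∀ k : ℕ, ∃ n : ℕ,
      ((2 : ℝ) ^ k) ^ k ≤ ∑ i ∈ Finset.range (n + 1), 1 / ((i : ℝ) + 1) := fun k =>
    ((Real.tendsto_sum_range_one_div_nat_succ_atTop.comp
      (Filter.tendsto_add_atTop_nat 1)).eventually_ge_atTop _).exists
  choose N hN using h
  exact ⟨N, hN⟩

end CyclicBlocks

open CyclicBlocks

/-- For every `r ∈ (0,1)` there exist Banach spaces `Z`, `W`, an
`r`-nuclear operator `t₁ : Z → W` and a nuclear operator `t₂ : W → Z` such that the
eigenvalue sequence of `t₂ ∘ t₁ : Z → Z` belongs to `ℓ_r` but does not belong to the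
Lorentz space `ℓ_{r,s}` for any `s < r`. -/
theorem exists_rNuclear_nuclear_eigenvalues_lr_not_lorentz
    (r : ℝ) (hr0 : 0 < r) (hr1 : r < 1) :
    ∃ (Z : Type) (_ : NormedAddCommGroup Z) (_ : NormedSpace ℂ Z) (_ : CompleteSpace Z)
      (W : Type) (_ : NormedAddCommGroup W) (_ : NormedSpace ℂ W) (_ : CompleteSpace W)
      (t₁ : Z →L[ℂ] W) (t₂ : W →L[ℂ] Z),
      RNuclear r t₁ ∧ RNuclear 1 t₂ ∧
      ∃ lam : ℕ → ℂ, IsEigenvalueSeq (t₂.comp t₁) lam ∧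
        (Summable fun n => ‖lam n‖ ^ r) ∧
        ∀ s : ℝ, 0 < s → s < r → ¬ MemLorentzSeq r s lam := by
  obtain ⟨N, hN⟩ := exists_le_blockHarmonic
  obtain ⟨e⟩ : Nonempty (ℕ ≃ CyclicBlocks N) := by
    have : Infinite (CyclicBlocks N) :=
      Infinite.of_injective (fun k => (⟨k, 0⟩ : CyclicBlocks N))
        fun k l h => congrArg Sigma.fst h
    obtain ⟨_⟩ := nonempty_denumerable (CyclicBlocks N)
    exact ⟨(Denumerable.eqv (CyclicBlocks N)).symm⟩
  let a : CyclicBlocks N → ℂ := fun p => (harmonicWeight N r p.1 p.2.val : ℂ)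
  have hnorm : ∀ p, ‖a p‖ = harmonicWeight N r p.1 p.2.val := fun p => by
    simp [a, abs_of_nonneg (harmonicWeight_nonneg (N := N) r p.1 p.2.val)]
  have ha : Summable fun p => ‖a p‖ ^ r := by
    simp_rw [hnorm]
    exact summable_harmonicWeight hr0
  obtain ⟨t₁, t₂, h₁, h₂, hdiag⟩ := exists_rNuclear_nuclear_diagonal hr0 hr1.le e ha
  let d : CyclicBlocks N → ℂ := fun p => (1 / 2 : ℂ) ^ p.1 * a p
  have hd : ∀ p, ‖d p‖ = (1 / 2 : ℝ) ^ p.1 * harmonicWeight N r p.1 p.2.val := fun p => by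
    rw [norm_mul, hnorm]
    simp
  have hsum : Summable fun p => ‖d p‖ ^ r := by
    refine Summable.of_nonneg_of_le (fun p => by positivity) (fun p => ?_) ha
    rw [hd, hnorm]
    have := harmonicWeight_nonneg (N := N) r p.1 p.2.val
    gcongr
    exact mul_le_of_le_one_left this (pow_le_one₀ (by norm_num) (by norm_num))
  have hfin : ∀ μ, μ ≠ 0 → {p | d p = μ}.Finite := fun μ hμ => by
    have hpos : 0 < ‖μ‖ ^ r := Real.rpow_pos_of_pos (norm_pos_iff.2 hμ) _
    have h := hsum.tendsto_cofinite_zero.eventually (gt_mem_nhds hpos)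
    refine (Filter.eventually_cofinite.1 h).subset fun p hp => ?_
    rw [Set.mem_ofPred_eq] at hp ⊢
    simp [hp]
  exact ⟨_, inferInstance, inferInstance, inferInstance, _, inferInstance, inferInstance,
    inferInstance, t₁, t₂, h₁, h₂, d ∘ e, isEigenvalueSeq_diagonal hdiag hfin e,
    e.summable_iff.2 hsum, fun s hs hsr => not_memLorentzSeq hr0 hs hsr hN e hd⟩

end
end

section
/- Let p, q ∈ (0,∞) with q > p. Then there exist sequences x, y ∈ ℓ_{p,q}(ℕ) such that the double family x ⊗ y := (x_n y_m)_{(n,m)∈ℕ×ℕ} does not belong to ℓ_{p,q}(ℕ×ℕ). -/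
noncomputable section
section DyadicTensor

open Finset

lemma seqApproxNum_nonneg {I : Type*} (x : I → ℂ) (n : ℕ) : 0 ≤ seqApproxNum x n :=
  Real.sInf_nonneg fun _ hc => hc.1

lemma seqApproxNum_succ_le_of_antitone {x : ℕ → ℂ} (hx : Antitone fun n => ‖x n‖) (n : ℕ) :
    seqApproxNum x (n + 1) ≤ ‖x n‖ := by
  refine le_of_forall_gt_imp_ge_of_dense fun c hc => ?_
  have hsub : {i : ℕ | c ≤ ‖x i‖} ⊆ (range n : Finset ℕ) := by
    intro i hi
    simp only [coe_range, Set.mem_Iio]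
    by_contra! hni
    exact absurd (hx hni) (not_le.2 (hc.trans_le hi))
  refine csInf_le ⟨0, fun _ h => h.1⟩
    ⟨(norm_nonneg _).trans hc.le, (finite_toSet _).subset hsub, ?_⟩
  have hcard := Nat.card_mono (finite_toSet (range n)) hsub
  rw [Nat.card_coe_set_eq (range n : Set ℕ), Set.ncard_coe_finset, card_range] at hcard
  exact Nat.lt_succ_of_le hcard

lemma le_seqApproxNum_of_card {I : Type*} {x : I → ℂ}
    (hx : BddAbove (Set.range fun i => ‖x i‖)) {n : ℕ} (hn : 0 < n) {v : ℝ} (S : Finset I)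
    (hS : n ≤ S.card) (hv : ∀ i ∈ S, v ≤ ‖x i‖) : v ≤ seqApproxNum x n := by
  refine le_csInf ?_ ?_
  · obtain ⟨B, hB⟩ := hx
    have hempty : {i : I | max B 0 + 1 ≤ ‖x i‖} = ∅ := by
      refine Set.eq_empty_of_forall_notMem fun i hi => ?_
      have h₁ : ‖x i‖ ≤ B := hB ⟨i, rfl⟩
      have h₂ : max B 0 + 1 ≤ ‖x i‖ := hi
      linarith [le_max_left B 0]
    refine ⟨max B 0 + 1, by positivity, ?_, ?_⟩
    · rw [hempty]; exact Set.finite_empty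
    · rw [hempty]; simpa using hn
  · rintro c ⟨-, hfin, hcard⟩
    by_contra! hcv
    have hsub : (S : Set I) ⊆ {i : I | c ≤ ‖x i‖} := fun i hi => hcv.le.trans (hv i hi)
    have hle := Nat.card_mono hfin hsub
    rw [Nat.card_coe_set_eq, Set.ncard_coe_finset] at hle
    omega

/-- The common value of `‖x n‖ ^ q` on the `k`-th dyadic block of the extremal sequence,
where `r = q / p`. -/
def dyadicWeight (r : ℝ) (k : ℕ) : ℝ :=
  ((k : ℝ) + 1) ^ (-((r + 1) / 2)) * ((2 : ℝ) ^ k) ^ (-r)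

lemma dyadicWeight_pos (r : ℝ) (k : ℕ) : 0 < dyadicWeight r k := by
  unfold dyadicWeight; positivity

lemma dyadicWeight_antitone {r : ℝ} (hr : 1 < r) : Antitone (dyadicWeight r) := by
  intro j k hjk
  unfold dyadicWeight
  have hjk' : (j : ℝ) ≤ k := by exact_mod_cast hjk
  refine mul_le_mul ?_ ?_ (by positivity) (by positivity)
  · exact Real.rpow_le_rpow_of_nonpos (by positivity) (by linarith) (by linarith)
  · exact Real.rpow_le_rpow_of_nonpos (by positivity)
      (pow_le_pow_right₀ one_le_two hjk) (by linarith)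

/-- A sequence that is constant on the dyadic blocks `2 ^ k ≤ n + 1 < 2 ^ (k + 1)`. -/
def dyadicSeq (r q : ℝ) (n : ℕ) : ℂ :=
  ((dyadicWeight r (Nat.log 2 (n + 1)) ^ (1 / q) : ℝ) : ℂ)

lemma norm_dyadicSeq (r q : ℝ) (n : ℕ) :
    ‖dyadicSeq r q n‖ = dyadicWeight r (Nat.log 2 (n + 1)) ^ (1 / q) := by
  rw [dyadicSeq, Complex.norm_real, Real.norm_of_nonneg]
  exact Real.rpow_nonneg (dyadicWeight_pos _ _).le _

lemma norm_dyadicSeq_antitone {r q : ℝ} (hr : 1 < r) (hq : 0 < q) :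
    Antitone fun n => ‖dyadicSeq r q n‖ := by
  intro m n hmn
  simp only [norm_dyadicSeq]
  exact Real.rpow_le_rpow (dyadicWeight_pos _ _).le
    (dyadicWeight_antitone hr (Nat.log_mono_right (by omega))) (by positivity)

lemma summable_dyadic {t : ℝ} (ht : 1 < t) :
    Summable fun n : ℕ => ((Nat.log 2 n : ℝ) + 1) ^ (-t) * ((2 : ℝ) ^ Nat.log 2 n)⁻¹ := by
  refine (summable_condensed_iff_of_nonneg (fun n => by positivity) ?_).1 ?_
  · intro m n _ hmn
    have hlog : Nat.log 2 m ≤ Nat.log 2 n := Nat.log_mono_right hmn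
    have hlog' : (Nat.log 2 m : ℝ) ≤ Nat.log 2 n := by exact_mod_cast hlog
    refine mul_le_mul ?_ ?_ (by positivity) (by positivity)
    · exact Real.rpow_le_rpow_of_nonpos (by positivity) (by linarith) (by linarith)
    · exact inv_anti₀ (by positivity) (pow_le_pow_right₀ one_le_two hlog)
  · have h := (summable_nat_add_iff 1).2 (Real.summable_nat_rpow.2 (neg_lt_neg ht))
    refine h.congr fun k => ?_
    rw [Nat.log_pow Nat.one_lt_two]
    push_cast
    field_simp

lemma memLorentzSeq_dyadicSeq {p q : ℝ} (hp : 0 < p) (hpq : p < q) :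
    MemLorentzSeq p q (dyadicSeq (q / p) q) := by
  have hq : 0 < q := hp.trans hpq
  have hr : 1 < q / p := (one_lt_div hp).2 hpq
  set r := q / p
  have hanti := norm_dyadicSeq_antitone hr hq
  refine ⟨⟨‖dyadicSeq r q 0‖, ?_⟩, ?_⟩
  · rintro _ ⟨n, rfl⟩
    exact hanti (Nat.zero_le n)
  have hsum := ((summable_nat_add_iff 1).2
    (summable_dyadic (t := (r + 1) / 2) (by linarith))).mul_left ((2 : ℝ) ^ (r - 1))
  refine hsum.of_nonneg_of_le
    (fun n => mul_nonneg (by positivity) (Real.rpow_nonneg (seqApproxNum_nonneg _ _) _))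
    fun n => ?_
  have hterm : seqApproxNum (dyadicSeq r q) (n + 1) ^ q
      ≤ dyadicWeight r (Nat.log 2 (n + 1)) := by
    calc seqApproxNum (dyadicSeq r q) (n + 1) ^ q ≤ ‖dyadicSeq r q n‖ ^ q :=
          Real.rpow_le_rpow (seqApproxNum_nonneg _ _)
            (seqApproxNum_succ_le_of_antitone hanti n) hq.le
      _ = _ := by
          rw [norm_dyadicSeq, one_div, Real.rpow_inv_rpow (dyadicWeight_pos _ _).le hq.ne']
  set k := Nat.log 2 (n + 1)
  have hn : (n : ℝ) + 1 ≤ 2 * 2 ^ k := by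
    have h := Nat.lt_pow_succ_log_self Nat.one_lt_two (n + 1)
    rw [pow_succ'] at h
    exact_mod_cast h.le
  calc ((n : ℝ) + 1) ^ (r - 1) * seqApproxNum (dyadicSeq r q) (n + 1) ^ q
      ≤ (2 * 2 ^ k : ℝ) ^ (r - 1) * dyadicWeight r k :=
        mul_le_mul (Real.rpow_le_rpow (by positivity) hn (by linarith)) hterm
          (Real.rpow_nonneg (seqApproxNum_nonneg _ _) _) (by positivity)
    _ = 2 ^ (r - 1) * (((k : ℝ) + 1) ^ (-((r + 1) / 2)) *
          (((2 : ℝ) ^ k) ^ (r - 1) * ((2 : ℝ) ^ k) ^ (-r))) := by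
        rw [dyadicWeight, Real.mul_rpow (by positivity) (by positivity)]; ring
    _ = _ := by
        rw [← Real.rpow_add (by positivity), show r - 1 + -r = -1 by ring, Real.rpow_neg_one]

lemma log_two_succ_eq_of_mem {k i : ℕ} (hi : i ∈ Ico (2 ^ k - 1) (2 ^ (k + 1) - 1)) :
    Nat.log 2 (i + 1) = k := by
  rw [mem_Ico] at hi
  exact Nat.log_eq_of_pow_le_of_lt_pow (by omega) (by omega)

/-- The index pairs whose dyadic block numbers add up to `m`. -/
def dyadicAntidiagonal (m : ℕ) : Finset (ℕ × ℕ) :=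
  (antidiagonal m).biUnion fun jk =>
    Ico (2 ^ jk.1 - 1) (2 ^ (jk.1 + 1) - 1) ×ˢ Ico (2 ^ jk.2 - 1) (2 ^ (jk.2 + 1) - 1)

lemma card_dyadicAntidiagonal (m : ℕ) : (dyadicAntidiagonal m).card = (m + 1) * 2 ^ m := by
  have hblock (k : ℕ) : (Ico (2 ^ k - 1) (2 ^ (k + 1) - 1)).card = 2 ^ k := by
    have := Nat.one_le_two_pow (n := k)
    rw [Nat.card_Ico, pow_succ]; omega
  rw [dyadicAntidiagonal, card_biUnion]
  · rw [sum_congr rfl (g := fun _ => 2 ^ m), sum_const, Nat.card_antidiagonal, smul_eq_mul]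
    intro jk hjk
    rw [card_product, hblock, hblock, ← pow_add, mem_antidiagonal.1 hjk]
  · intro a _ b _ hab
    refine disjoint_left.2 fun i hia hib => hab ?_
    rw [mem_product] at hia hib
    exact Prod.ext ((log_two_succ_eq_of_mem hia.1).symm.trans (log_two_succ_eq_of_mem hib.1))
      ((log_two_succ_eq_of_mem hia.2).symm.trans (log_two_succ_eq_of_mem hib.2))

lemma le_dyadicWeight_mul {r : ℝ} (hr : 1 < r) (j k : ℕ) :
    (((j + k : ℕ) : ℝ) + 1) ^ (-(r + 1)) * ((2 : ℝ) ^ (j + k)) ^ (-r)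
      ≤ dyadicWeight r j * dyadicWeight r k := by
  have hle {a b : ℕ} (hab : a ≤ b) :
      ((b : ℝ) + 1) ^ (-((r + 1) / 2)) ≤ ((a : ℝ) + 1) ^ (-((r + 1) / 2)) := by
    have hab' : (a : ℝ) ≤ b := by exact_mod_cast hab
    exact Real.rpow_le_rpow_of_nonpos (by positivity) (by linarith) (by linarith)
  calc (((j + k : ℕ) : ℝ) + 1) ^ (-(r + 1)) * ((2 : ℝ) ^ (j + k)) ^ (-r)
      = ((((j + k : ℕ) : ℝ) + 1) ^ (-((r + 1) / 2)) * (((j + k : ℕ) : ℝ) + 1) ^ (-((r + 1) / 2)))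
        * (((2 : ℝ) ^ j) ^ (-r) * ((2 : ℝ) ^ k) ^ (-r)) := by
        rw [← Real.rpow_add (by positivity), ← Real.mul_rpow (by positivity) (by positivity),
          ← pow_add]
        ring_nf
    _ ≤ (((j : ℝ) + 1) ^ (-((r + 1) / 2)) * ((k : ℝ) + 1) ^ (-((r + 1) / 2)))
        * (((2 : ℝ) ^ j) ^ (-r) * ((2 : ℝ) ^ k) ^ (-r)) := by
        refine mul_le_mul_of_nonneg_right ?_ (by positivity)
        exact mul_le_mul (hle (Nat.le_add_right j k)) (hle (Nat.le_add_left k j))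
          (by positivity) (by positivity)
    _ = _ := by unfold dyadicWeight; ring

lemma le_seqApproxNum_tensor_rpow {r q : ℝ} (hr : 1 < r) (hq : 0 < q)
    (hbdd : BddAbove (Set.range fun nm : ℕ × ℕ => ‖dyadicSeq r q nm.1 * dyadicSeq r q nm.2‖))
    {n m : ℕ} (hn : n + 1 ≤ (m + 1) * 2 ^ m) :
    ((m : ℝ) + 1) ^ (-(r + 1)) * ((2 : ℝ) ^ m) ^ (-r) ≤
      seqApproxNum (fun nm : ℕ × ℕ => dyadicSeq r q nm.1 * dyadicSeq r q nm.2) (n + 1) ^ q := by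
  rw [← Real.rpow_inv_le_iff_of_pos (by positivity) (seqApproxNum_nonneg _ _) hq]
  refine le_seqApproxNum_of_card hbdd n.succ_pos (dyadicAntidiagonal m)
    (hn.trans (card_dyadicAntidiagonal m).ge) ?_
  rintro ⟨a, b⟩ hab
  obtain ⟨⟨j, k⟩, hjk, hmem⟩ := mem_biUnion.1 hab
  obtain rfl := mem_antidiagonal.1 hjk
  rw [mem_product] at hmem
  rw [norm_mul, norm_dyadicSeq, norm_dyadicSeq, log_two_succ_eq_of_mem hmem.1,
    log_two_succ_eq_of_mem hmem.2, one_div,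
    ← Real.mul_rpow (dyadicWeight_pos _ _).le (dyadicWeight_pos _ _).le]
  exact Real.rpow_le_rpow (by positivity) (le_dyadicWeight_mul hr j k) (by positivity)

lemma not_memLorentzSeq_dyadicSeq_tensor {p q : ℝ} (hp : 0 < p) (hpq : p < q) :
    ¬ MemLorentzSeq p q
      (fun nm : ℕ × ℕ => dyadicSeq (q / p) q nm.1 * dyadicSeq (q / p) q nm.2) := by
  have hq : 0 < q := hp.trans hpq
  have hr : 1 < q / p := (one_lt_div hp).2 hpq
  set r := q / p
  rintro ⟨hbdd, hsum⟩
  set f : ℕ → ℝ := fun n => ((n : ℝ) + 1) ^ (r - 1) *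
    seqApproxNum (fun nm : ℕ × ℕ => dyadicSeq r q nm.1 * dyadicSeq r q nm.2) (n + 1) ^ q with hf
  have hf_nonneg (n : ℕ) : 0 ≤ f n :=
    mul_nonneg (by positivity) (Real.rpow_nonneg (seqApproxNum_nonneg _ _) _)
  have hblock (m : ℕ) : (4 : ℝ) ^ (-r) * ((m : ℝ) + 2)⁻¹ ≤
      ∑ n ∈ Ico ((m + 1) * 2 ^ m) ((m + 2) * 2 ^ (m + 1)), f n := by
    set N : ℝ := ((m : ℝ) + 2) * 2 ^ (m + 1) with hN
    have hNpos : 0 < N := by positivity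
    set V : ℝ := ((m : ℝ) + 2) ^ (-(r + 1)) * ((2 : ℝ) ^ (m + 1)) ^ (-r) with hV
    have hVpos : 0 < V := by positivity
    have hpow : (0 : ℝ) < 2 ^ m := by positivity
    have hlow : ∀ n ∈ Ico ((m + 1) * 2 ^ m) ((m + 2) * 2 ^ (m + 1)),
        (N / 4) ^ (r - 1) * V ≤ f n := by
      intro n hn
      rw [mem_Ico] at hn
      refine mul_le_mul ?_ ?_ hVpos.le (by positivity)
      · refine Real.rpow_le_rpow (by positivity) ?_ (by linarith)
        have h : ((m : ℝ) + 1) * 2 ^ m ≤ n := by exact_mod_cast hn.1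
        rw [hN, pow_succ]
        nlinarith [mul_nonneg (Nat.cast_nonneg (α := ℝ) m) hpow.le]
      · have h := le_seqApproxNum_tensor_rpow (m := m + 1) hr hq hbdd hn.2
        push_cast at h
        rwa [add_assoc, one_add_one_eq_two] at h
    have hcard : N / 4 ≤ ((Ico ((m + 1) * 2 ^ m) ((m + 2) * 2 ^ (m + 1))).card : ℝ) := by
      rw [Nat.card_Ico, Nat.cast_sub]
      · push_cast
        rw [hN, pow_succ]
        nlinarith [mul_nonneg (Nat.cast_nonneg (α := ℝ) m) hpow.le]
      · exact Nat.mul_le_mul (by omega) (Nat.pow_le_pow_right two_pos (by omega))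
    calc (4 : ℝ) ^ (-r) * ((m : ℝ) + 2)⁻¹ = (N / 4) ^ r * V := by
          rw [Real.div_rpow hNpos.le (by norm_num), hN, hV,
            Real.mul_rpow (by positivity) (by positivity), neg_add,
            Real.rpow_add (by positivity), Real.rpow_neg_one,
            Real.rpow_neg (by positivity), Real.rpow_neg (by positivity),
            Real.rpow_neg (by positivity)]
          have h₁ : ((m : ℝ) + 2) ^ r ≠ 0 := by positivity
          have h₂ : ((2 : ℝ) ^ (m + 1)) ^ r ≠ 0 := by positivity
          field_simp
      _ = N / 4 * ((N / 4) ^ (r - 1) * V) := by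
          rw [Real.rpow_sub_one (by positivity)]; field_simp
      _ ≤ _ := mul_le_mul_of_nonneg_right hcard (by positivity)
      _ ≤ _ := by
          rw [← nsmul_eq_mul]
          exact card_nsmul_le_sum _ _ _ hlow
  have hpartial (M : ℕ) : ∑ m ∈ range M, (4 : ℝ) ^ (-r) * ((m : ℝ) + 2)⁻¹ ≤
      ∑ n ∈ range ((M + 1) * 2 ^ M), f n := by
    induction M with
    | zero => simpa using hf_nonneg 0
    | succ M ih =>
      rw [sum_range_succ, ← sum_range_add_sum_Ico f
        (Nat.mul_le_mul (Nat.le_succ (M + 1)) (Nat.pow_le_pow_right two_pos M.le_succ))]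
      exact add_le_add ih (hblock M)
  have hharm : Summable fun m : ℕ => (4 : ℝ) ^ (-r) * ((m : ℝ) + 2)⁻¹ :=
    summable_of_sum_range_le (fun m => by positivity) fun M =>
      (hpartial M).trans (hsum.sum_le_tsum _ fun n _ => hf_nonneg n)
  rw [summable_mul_left_iff (by positivity)] at hharm
  refine Real.not_summable_natCast_inv ((summable_nat_add_iff 2).1 ?_)
  simpa using hharm

end DyadicTensor

noncomputable section

/-- **Statement 18.** Let `p, q ∈ (0,∞)` with `q > p`. Then there exist sequences
`x, y ∈ ℓ_{p,q}(ℕ)` such that the double family `x ⊗ y = (x_n y_m)` does not belong to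
`ℓ_{p,q}(ℕ×ℕ)`. -/
theorem exists_lorentz_tensor_not_lorentz
    (p q : ℝ) (hp : 0 < p) (hq : 0 < q) (hpq : p < q) :
    ∃ x y : ℕ → ℂ, MemLorentzSeq p q x ∧ MemLorentzSeq p q y ∧
      ¬ MemLorentzSeq p q (fun nm : ℕ × ℕ => x nm.1 * y nm.2) := by
  exact ⟨_, _, memLorentzSeq_dyadicSeq hp hpq, memLorentzSeq_dyadicSeq hp hpq,
    not_memLorentzSeq_dyadicSeq_tensor hp hpq⟩

end
end
end
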